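/- arXiv:1712.06498 — 14 statements merged into one kernel-verified Lean document; each statement's English description precedes it below -/
import Mathlib

section
/- Let x_1, x_2, ..., x_n be real numbers with sum 0, let C_j = (1/j)·(x_1 + ... + x_j) for j = 1, ..., n, and let R = max_{1 ≤ j ≤ n} C_j and L = min_{1 ≤ j ≤ n} C_j. Then R − L ≥ |x_i| / i for every i = 1, ..., n. -/
/-- For real numbers x_1, ..., x_n summing to 0, with prefix centers of
gravity C_j = (1/j)·(x_1 + ... + x_j), R = max_j C_j and L = min_j C_j, we have
R − L ≥ |x_i| / i for every i = 1, ..., n. -/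
theorem stmt_0 (n : ℕ) (hn : 1 ≤ n) (x : ℕ → ℝ)
    (hsum : ∑ i ∈ Finset.Icc 1 n, x i = 0) :
    ∀ i ∈ Finset.Icc 1 n,
      |x i| / (i : ℝ) ≤
        (Finset.Icc 1 n).sup' (Finset.nonempty_Icc.mpr hn)
            (fun j => (∑ k ∈ Finset.Icc 1 j, x k) / (j : ℝ)) -
        (Finset.Icc 1 n).inf' (Finset.nonempty_Icc.mpr hn)
            (fun j => (∑ k ∈ Finset.Icc 1 j, x k) / (j : ℝ)) := by
  set C : ℕ → ℝ := fun j => (∑ k ∈ Finset.Icc 1 j, x k) / (j : ℝ) with hC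
  set R := (Finset.Icc 1 n).sup' (Finset.nonempty_Icc.mpr hn) C
  set L := (Finset.Icc 1 n).inf' (Finset.nonempty_Icc.mpr hn) C
  have hR : ∀ j ∈ Finset.Icc 1 n, C j ≤ R := fun j hj => Finset.le_sup' C hj
  have hL : ∀ j ∈ Finset.Icc 1 n, L ≤ C j := fun j hj => Finset.inf'_le C hj
  have hCn : C n = 0 := by simp [hC, hsum]
  have hn_mem : n ∈ Finset.Icc 1 n := Finset.mem_Icc.mpr ⟨hn, le_rfl⟩
  have hR0 : 0 ≤ R := hCn ▸ hR n hn_mem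
  have hL0 : L ≤ 0 := hCn ▸ hL n hn_mem
  have partial_sum_bounds : ∀ m ≤ n, m * L ≤ ∑ k ∈ Finset.Icc 1 m, x k ∧
      ∑ k ∈ Finset.Icc 1 m, x k ≤ m * R := by
    intro m hm
    rcases Nat.eq_zero_or_pos m with rfl | hpos
    · simp
    · have hmem : m ∈ Finset.Icc 1 n := Finset.mem_Icc.mpr ⟨hpos, hm⟩
      have hm' : (0 : ℝ) < m := Nat.cast_pos.mpr hpos
      exact ⟨(le_div_iff₀' hm').mp (hL m hmem), (div_le_iff₀' hm').mp (hR m hmem)⟩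
  intro i hi
  obtain ⟨hi1, hin⟩ := Finset.mem_Icc.mp hi
  obtain ⟨m, rfl⟩ := Nat.exists_eq_add_of_le' hi1
  obtain ⟨hlo, hhi⟩ := partial_sum_bounds m (by omega)
  obtain ⟨hlo', hhi'⟩ := partial_sum_bounds (m + 1) hin
  rw [Finset.sum_Icc_succ_top (by omega)] at hlo' hhi'
  rw [div_le_iff₀ (by positivity), abs_le]
  push_cast at *
  constructor <;> linarith
end

section
/- Let x_1, ..., x_n be real numbers with sum 0 and let u_1, ..., u_n be the same multiset reindexed so that |u_1| ≤ |u_2| ≤ ... ≤ |u_n|. Then for every permutation π of {1, ..., n} and every i = 1, ..., n, the span of the reordered sequence x_{π(1)}, ..., x_{π(n)} (i.e., max_j C_j − min_j C_j of its prefix centers) is at least |u_i| / i. -/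
/-- Each term of a sequence is bounded by its position times the width of an interval
containing `0` and all prefix averages. -/
theorem abs_le_mul_sub_of_prefix_average_mem_Icc (y : ℕ → ℝ) (n : ℕ) (m M : ℝ)
    (hm : m ≤ 0) (hM : 0 ≤ M)
    (h : ∀ j ∈ Finset.Icc 1 n, (∑ k ∈ Finset.Icc 1 j, y k) / (j : ℝ) ∈ Set.Icc m M)
    (k : ℕ) (hk : k ∈ Finset.Icc 1 n) : |y k| ≤ k * (M - m) := by
  have hS : ∀ j ≤ n, j * m ≤ ∑ k ∈ Finset.Icc 1 j, y k ∧
      ∑ k ∈ Finset.Icc 1 j, y k ≤ j * M := by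
    intro j hj
    rcases Nat.eq_zero_or_pos j with rfl | hpos
    · simp
    · have hpos' : (0 : ℝ) < j := by exact_mod_cast hpos
      obtain ⟨h1, h2⟩ := h j (Finset.mem_Icc.mpr ⟨hpos, hj⟩)
      rw [le_div_iff₀ hpos'] at h1
      rw [div_le_iff₀ hpos'] at h2
      constructor <;> linarith
  rw [Finset.mem_Icc] at hk
  obtain ⟨l, rfl⟩ := Nat.exists_eq_add_of_le' hk.1
  obtain ⟨h1, h2⟩ := hS l (by omega)
  obtain ⟨h3, h4⟩ := hS (l + 1) hk.2
  rw [Finset.sum_Icc_succ_top (by omega)] at h3 h4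
  push_cast at *
  rw [abs_le]
  constructor <;> linarith

/-- If `π` and `σ` are permutations of `{1, ..., n}`, then one of the values `π 1, ..., π i` is
attained by `σ` at an argument that is at least `i`. -/
theorem exists_le_apply_eq_of_bijOn {n : ℕ} {σ π : ℕ → ℕ}
    (hσ : Set.BijOn σ (Set.Icc 1 n) (Set.Icc 1 n))
    (hπ : Set.BijOn π (Set.Icc 1 n) (Set.Icc 1 n)) {i : ℕ} (hi : i ∈ Set.Icc 1 n) :
    ∃ k ∈ Set.Icc 1 i, ∃ j ∈ Set.Icc i n, σ j = π k := by
  obtain ⟨hi1, hin⟩ := hi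
  by_contra! hcon
  have hsub : (Finset.Icc 1 i).image π ⊆ (Finset.Icc 1 (i - 1)).image σ := by
    intro a ha
    obtain ⟨k, hk, rfl⟩ := Finset.mem_image.mp ha
    rw [Finset.mem_Icc] at hk
    obtain ⟨j, hj, hjk⟩ := hσ.surjOn (hπ.mapsTo ⟨hk.1, hk.2.trans hin⟩)
    refine Finset.mem_image.mpr ⟨j, Finset.mem_Icc.mpr ⟨hj.1, ?_⟩, hjk⟩
    by_contra hlt
    exact hcon k hk j ⟨by omega, hj.2⟩ hjk
  have hinj : Set.InjOn π (Finset.Icc 1 i : Finset ℕ) :=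
    hπ.injOn.mono (by
      rw [Finset.coe_Icc]
      exact Set.Icc_subset_Icc_right hin)
  have hcard := (Finset.card_le_card hsub).trans Finset.card_image_le
  rw [Finset.card_image_of_injOn hinj, Nat.card_Icc, Nat.card_Icc] at hcard
  omega

/-- If x_1, ..., x_n sum to 0 and u_1, ..., u_n is the same multiset
reindexed so that |u_1| ≤ ... ≤ |u_n|, then for every permutation π of {1, ..., n}
and every i, the span of the reordered sequence x_{π(1)}, ..., x_{π(n)} is at least
|u_i| / i. -/
theorem stmt_1 (n : ℕ) (hn : 1 ≤ n) (x u : ℕ → ℝ)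
    (hsum : ∑ i ∈ Finset.Icc 1 n, x i = 0)
    (σ : ℕ → ℕ) (hσ : Set.BijOn σ (Set.Icc 1 n) (Set.Icc 1 n))
    (huσ : ∀ i ∈ Set.Icc 1 n, u i = x (σ i))
    (hmono : ∀ i ∈ Set.Icc 1 n, ∀ j ∈ Set.Icc 1 n, i ≤ j → |u i| ≤ |u j|)
    (π : ℕ → ℕ) (hπ : Set.BijOn π (Set.Icc 1 n) (Set.Icc 1 n)) :
    ∀ i ∈ Finset.Icc 1 n,
      |u i| / (i : ℝ) ≤
        (Finset.Icc 1 n).sup' (Finset.nonempty_Icc.mpr hn)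
            (fun j => (∑ k ∈ Finset.Icc 1 j, x (π k)) / (j : ℝ)) -
        (Finset.Icc 1 n).inf' (Finset.nonempty_Icc.mpr hn)
            (fun j => (∑ k ∈ Finset.Icc 1 j, x (π k)) / (j : ℝ)) := by
  intro i hi
  obtain ⟨hi1, hin⟩ := Finset.mem_Icc.mp hi
  have hipos : (0 : ℝ) < i := by exact_mod_cast hi1
  set C : ℕ → ℝ := fun j => (∑ k ∈ Finset.Icc 1 j, x (π k)) / (j : ℝ) with hC
  have hmem : ∀ j ∈ Finset.Icc 1 n,
      C j ∈ Set.Icc ((Finset.Icc 1 n).inf' (Finset.nonempty_Icc.mpr hn) C)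
        ((Finset.Icc 1 n).sup' (Finset.nonempty_Icc.mpr hn) C) :=
    fun j hj => ⟨Finset.inf'_le C hj, Finset.le_sup' C hj⟩
  have hCn : C n = 0 := by
    have hπ' : Set.BijOn π (Finset.Icc 1 n : Finset ℕ) (Finset.Icc 1 n : Finset ℕ) := by
      simpa only [Finset.coe_Icc] using hπ
    have hsumπ : ∑ k ∈ Finset.Icc 1 n, x (π k) = 0 := by
      rw [← hsum]
      exact Finset.sum_nbij π hπ'.mapsTo hπ'.injOn hπ'.surjOn fun _ _ => rfl
    simp only [hC, hsumπ, zero_div]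
  obtain ⟨hm, hM⟩ := hmem n (Finset.mem_Icc.mpr ⟨hn, le_rfl⟩)
  rw [hCn] at hm hM
  obtain ⟨k, hk, j, hj, hjk⟩ := exists_le_apply_eq_of_bijOn hσ hπ ⟨hi1, hin⟩
  have hj' : j ∈ Set.Icc 1 n := ⟨hi1.trans hj.1, hj.2⟩
  have hki : (k : ℝ) ≤ i := by exact_mod_cast hk.2
  rw [div_le_iff₀' hipos]
  calc |u i| ≤ |u j| := hmono i ⟨hi1, hin⟩ j hj' hj.1
    _ = |x (π k)| := by rw [huσ j hj', hjk]
    _ ≤ k * _ := abs_le_mul_sub_of_prefix_average_mem_Icc (fun k => x (π k)) n _ _ hm hM hmem k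
        (Finset.mem_Icc.mpr ⟨hk.1, hk.2.trans hin⟩)
    _ ≤ i * _ := mul_le_mul_of_nonneg_right hki (sub_nonneg.mpr (hm.trans hM))
end

section
/- Let P_1 ≤ P_2 ≤ ... ≤ P_a be positive reals and N_1, ..., N_b be negative reals with |N_1| ≤ |N_2| ≤ ... ≤ |N_b|, such that Σ_{l=1}^{a} P_l + Σ_{l=1}^{b} N_l = 0. Define π⁺_j = j + max{ k ∈ {0, ..., b} : Σ_{i=1}^{k} |N_i| ≤ Σ_{l=1}^{j} P_l } for j = 1, ..., a, and π⁻_j = j + max{ k ∈ {0, ..., a} : Σ_{i=1}^{k} P_i < Σ_{l=1}^{j} |N_l| } for j = 1, ..., b. Then for every ordering (permutation) of the combined multiset of the a + b numbers, the span of the resulting sequence is at least P_j / π⁺_j for every j = 1, ..., a, and at least |N_j| / π⁻_j for every j = 1, ..., b. -/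
open scoped Classical

/-- Any `c` or more terms taken from a nonnegative monotone sequence sum to at least the sum of
its first `c` terms. -/
theorem sum_Icc_le_multiset_sum (M : ℕ → ℝ) (b : ℕ)
    (hM : ∀ i ∈ Finset.Icc 1 b, 0 ≤ M i)
    (hmono : ∀ i ∈ Finset.Icc 1 b, ∀ j ∈ Finset.Icc 1 b, i ≤ j → M i ≤ M j)
    (c : ℕ) (T : Multiset ℝ) (hT : T ≤ (Finset.Icc 1 b).val.map M) (hc : c ≤ T.card) :
    ∑ i ∈ Finset.Icc 1 c, M i ≤ T.sum := by
  induction b generalizing c T with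
  | zero =>
    have hT0 : T = 0 := by simpa using hT
    subst hT0
    have hc0 : c = 0 := by simpa using hc
    simp [hc0]
  | succ b ih =>
    have hsub : ∀ i ∈ Finset.Icc 1 b, i ∈ Finset.Icc 1 (b + 1) := fun i hi => by
      simp only [Finset.mem_Icc] at hi ⊢; omega
    have ih' := ih (fun i hi => hM i (hsub i hi))
      (fun i hi j hj => hmono i (hsub i hi) j (hsub j hj))
    have hcons : (Finset.Icc 1 (b + 1)).val.map M = M (b + 1) ::ₘ (Finset.Icc 1 b).val.map M := by
      rw [← Finset.insert_Icc_right_eq_Icc_add_one (by omega : 1 ≤ b + 1),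
        Finset.insert_val_of_notMem (by simp), Multiset.map_cons]
    have hcard : c ≤ b + 1 := by
      have := Multiset.card_le_card hT
      simp at this
      omega
    rw [hcons] at hT
    by_cases hmem : M (b + 1) ∈ T
    · obtain ⟨T', rfl⟩ := Multiset.exists_cons_of_mem hmem
      have hT' := (Multiset.cons_le_cons_iff _).mp hT
      rw [Multiset.card_cons] at hc
      rw [Multiset.sum_cons]
      rcases c with _ | c
      · have h0 := ih' 0 T' hT' (Nat.zero_le _)
        have hb := hM (b + 1) (by simp)
        simp at h0 ⊢
        linarith
      · rw [Finset.sum_Icc_succ_top (by omega)]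
        have h1 := ih' c T' hT' (by omega)
        have h2 := hmono (c + 1) (by simp; omega) (b + 1) (by simp) hcard
        linarith
    · exact ih' c T ((Multiset.le_cons_of_notMem hmem).mp hT) hc

/-- In an ordering of the values `P i` and `-M i`, either a value at least `P j` occurs among the
first `j + k` entries, or these entries sum to at most `-P j`. -/
theorem exists_ge_or_sum_le (a b : ℕ) (P M y : ℕ → ℝ)
    (hP : ∀ i ∈ Finset.Icc 1 a, 0 ≤ P i)
    (hPmono : ∀ i ∈ Finset.Icc 1 a, ∀ j ∈ Finset.Icc 1 a, i ≤ j → P i ≤ P j)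
    (hM : ∀ i ∈ Finset.Icc 1 b, 0 ≤ M i)
    (hMmono : ∀ i ∈ Finset.Icc 1 b, ∀ j ∈ Finset.Icc 1 b, i ≤ j → M i ≤ M j)
    (hy : (Finset.Icc 1 (a + b)).val.map y =
      (Finset.Icc 1 a).val.map P + (Finset.Icc 1 b).val.map (fun i => -M i))
    (j k : ℕ) (hj : j ∈ Finset.Icc 1 a) (hkb : k ≤ b)
    (hk : k + 1 ≤ b → ∑ l ∈ Finset.Icc 1 j, P l ≤ ∑ i ∈ Finset.Icc 1 (k + 1), M i) :
    (∃ m ∈ Finset.Icc 1 (j + k), P j ≤ y m) ∨ ∑ m ∈ Finset.Icc 1 (j + k), y m ≤ -P j := by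
  rw [or_iff_not_imp_left]
  intro hlt
  push Not at hlt
  have hj' := Finset.mem_Icc.mp hj
  set T := (Finset.Icc 1 (j + k)).val.map y with hT
  have hTle : T ≤ (Finset.Icc 1 a).val.map P + (Finset.Icc 1 b).val.map (fun i => -M i) := by
    rw [← hy]
    exact Multiset.map_le_map (Finset.val_le_iff.mpr
      (Finset.Icc_subset_Icc le_rfl (by omega)))
  have hTlt : ∀ x ∈ T, x < P j := by
    intro x hx
    obtain ⟨m, hm, rfl⟩ := Multiset.mem_map.mp hx
    exact hlt m hm
  obtain ⟨T₁, T₂, h₁, h₂, hadd⟩ : ∃ T₁ T₂, T₁ ≤ (Finset.Icc 1 a).val.map P ∧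
      T₂ ≤ (Finset.Icc 1 b).val.map (fun i => -M i) ∧ T = T₁ + T₂ := by
    refine ⟨T ∩ (Finset.Icc 1 a).val.map P, T - (Finset.Icc 1 a).val.map P,
      Multiset.inter_le_right, ?_, ?_⟩
    · rwa [Multiset.sub_le_iff_le_add']
    · rw [add_comm, Multiset.sub_add_inter]
  have hsplit : (Finset.Icc 1 a).val =
      (Finset.Icc 1 (j - 1)).val + (Finset.Icc j a).val := by
    have hdisj : Disjoint (Finset.Icc 1 (j - 1)) (Finset.Icc j a) := by
      rw [Finset.disjoint_left]
      intro i h h'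
      simp only [Finset.mem_Icc] at h h'
      omega
    rw [← Finset.disjUnion_val _ _ hdisj, Finset.disjUnion_eq_union]
    congr 1
    ext i
    simp only [Finset.mem_Icc, Finset.mem_union]
    omega
  have h₁' : T₁ ≤ (Finset.Icc 1 (j - 1)).val.map P := by
    have hf := Multiset.filter_le_filter (· < P j) h₁
    rw [Multiset.filter_eq_self.mpr
      (fun x hx => hTlt x (hadd ▸ Multiset.mem_add.mpr (Or.inl hx))), hsplit,
      Multiset.map_add, Multiset.filter_add,
      (Multiset.filter_eq_nil (s := (Finset.Icc j a).val.map P)).mpr, add_zero] at hf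
    · exact hf.trans (Multiset.filter_le _ _)
    · intro x hx
      obtain ⟨i, hi, rfl⟩ := Multiset.mem_map.mp hx
      have hi' := Finset.mem_Icc.mp (Finset.mem_val.mp hi)
      exact not_lt.mpr (hPmono j hj i (Finset.mem_Icc.mpr ⟨by omega, hi'.2⟩) hi'.1)
  have hcard₁ : T₁.card ≤ j - 1 := by simpa using Multiset.card_le_card h₁'
  have hsum₁ : T₁.sum ≤ ∑ l ∈ Finset.Icc 1 (j - 1), P l := by
    obtain ⟨R, hR⟩ := Multiset.le_iff_exists_add.mp h₁'
    have hRnonneg : 0 ≤ R.sum := by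
      refine Multiset.sum_nonneg fun x hx => ?_
      have hx' : x ∈ (Finset.Icc 1 (j - 1)).val.map P :=
        hR ▸ Multiset.mem_add.mpr (Or.inr hx)
      obtain ⟨i, hi, rfl⟩ := Multiset.mem_map.mp hx'
      have hi' := Finset.mem_Icc.mp (Finset.mem_val.mp hi)
      exact hP i (Finset.mem_Icc.mpr ⟨hi'.1, by omega⟩)
    have hRsum := congrArg Multiset.sum hR
    rw [Multiset.sum_add] at hRsum
    change ∑ l ∈ Finset.Icc 1 (j - 1), P l = _ at hRsum
    linarith
  have hcard : T.card = j + k := by simp [hT]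
  have hcard₂ : k + 1 ≤ T₂.card := by
    rw [hadd, Multiset.card_add] at hcard
    omega
  have hcardb : T₂.card ≤ b := by simpa using Multiset.card_le_card h₂
  have h₂' : T₂.map Neg.neg ≤ (Finset.Icc 1 b).val.map M := by
    simpa [Multiset.map_map, Function.comp_def] using Multiset.map_le_map (f := Neg.neg) h₂
  have hsum₂ := sum_Icc_le_multiset_sum M b hM hMmono (k + 1) _ h₂' (by simpa using hcard₂)
  rw [Multiset.sum_map_neg'] at hsum₂
  have hPM := hk (hcard₂.trans hcardb)
  have hlast : ∑ l ∈ Finset.Icc 1 j, P l = ∑ l ∈ Finset.Icc 1 (j - 1), P l + P j := by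
    obtain ⟨i, rfl⟩ : ∃ i, j = i + 1 := ⟨j - 1, by omega⟩
    exact Finset.sum_Icc_succ_top (by omega) P
  have hTsum : ∑ m ∈ Finset.Icc 1 (j + k), y m = T₁.sum + T₂.sum := by
    rw [← Multiset.sum_add, ← hadd]
    rfl
  linarith

/-- If all prefix averages of `y` up to `n` lie in `[L, U] ∋ 0`, then the `m`-th entry is at most
`m * (U - L)`. -/
theorem le_mul_of_prefix_average_mem (n : ℕ) (y : ℕ → ℝ) (L U : ℝ) (hL0 : L ≤ 0)
    (hL : ∀ m ∈ Finset.Icc 1 n, L ≤ (∑ i ∈ Finset.Icc 1 m, y i) / (m : ℝ))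
    (hU : ∀ m ∈ Finset.Icc 1 n, (∑ i ∈ Finset.Icc 1 m, y i) / (m : ℝ) ≤ U)
    (m : ℕ) (hm : m ∈ Finset.Icc 1 n) : y m ≤ m * (U - L) := by
  have hm' := Finset.mem_Icc.mp hm
  obtain ⟨i, rfl⟩ : ∃ i, m = i + 1 := ⟨m - 1, by omega⟩
  have hUm := hU _ hm
  rw [div_le_iff₀ (by positivity), Finset.sum_Icc_succ_top (by omega)] at hUm
  have hLi : L * i ≤ ∑ l ∈ Finset.Icc 1 i, y l := by
    rcases Nat.eq_zero_or_pos i with rfl | hi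
    · simp
    · exact (le_div_iff₀ (by positivity)).mp
        (hL i (Finset.mem_Icc.mpr ⟨hi, by omega⟩))
  push_cast at hUm ⊢
  linarith

/-- The lower bound on the span coming from a single value `P j`. -/
theorem div_le_sub_of_prefix_average_mem (a b : ℕ) (P M y : ℕ → ℝ) (L U : ℝ)
    (hP : ∀ i ∈ Finset.Icc 1 a, 0 ≤ P i)
    (hPmono : ∀ i ∈ Finset.Icc 1 a, ∀ j ∈ Finset.Icc 1 a, i ≤ j → P i ≤ P j)
    (hM : ∀ i ∈ Finset.Icc 1 b, 0 ≤ M i)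
    (hMmono : ∀ i ∈ Finset.Icc 1 b, ∀ j ∈ Finset.Icc 1 b, i ≤ j → M i ≤ M j)
    (hy : (Finset.Icc 1 (a + b)).val.map y =
      (Finset.Icc 1 a).val.map P + (Finset.Icc 1 b).val.map (fun i => -M i))
    (hL0 : L ≤ 0) (hU0 : 0 ≤ U)
    (hL : ∀ m ∈ Finset.Icc 1 (a + b), L ≤ (∑ i ∈ Finset.Icc 1 m, y i) / (m : ℝ))
    (hU : ∀ m ∈ Finset.Icc 1 (a + b), (∑ i ∈ Finset.Icc 1 m, y i) / (m : ℝ) ≤ U)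
    (j k : ℕ) (hj : j ∈ Finset.Icc 1 a) (hkb : k ≤ b)
    (hk : k + 1 ≤ b → ∑ l ∈ Finset.Icc 1 j, P l ≤ ∑ i ∈ Finset.Icc 1 (k + 1), M i) :
    P j / ((j + k : ℕ) : ℝ) ≤ U - L := by
  have hj' := Finset.mem_Icc.mp hj
  have hpos : (0 : ℝ) < ((j + k : ℕ) : ℝ) := by
    exact_mod_cast (by omega : 0 < j + k)
  rw [div_le_iff₀ hpos]
  rcases exists_ge_or_sum_le a b P M y hP hPmono hM hMmono hy j k hj hkb hk with
    ⟨m, hm, hle⟩ | hle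
  · have hm' := Finset.mem_Icc.mp hm
    have hym := le_mul_of_prefix_average_mem (a + b) y L U hL0 hL hU m
      (Finset.mem_Icc.mpr ⟨hm'.1, by omega⟩)
    have hmk : (m : ℝ) ≤ ((j + k : ℕ) : ℝ) := by exact_mod_cast hm'.2
    have := mul_le_mul_of_nonneg_right hmk (by linarith : 0 ≤ U - L)
    linarith
  · have hLm := hL (j + k) (Finset.mem_Icc.mpr ⟨by omega, by omega⟩)
    rw [le_div_iff₀ hpos] at hLm
    nlinarith [mul_nonneg hU0 hpos.le]

/-- With positive values P_1 ≤ ... ≤ P_a and negative values N_1, ..., N_b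
(|N_1| ≤ ... ≤ |N_b|) summing to 0 overall, define
π⁺_j = j + max{k : Σ_{i≤k} |N_i| ≤ Σ_{l≤j} P_l} and
π⁻_j = j + max{k : Σ_{i≤k} P_i < Σ_{l≤j} |N_l|}. Then for every ordering y of the
combined multiset of the a + b numbers, the span of y is at least P_j / π⁺_j for each
j = 1,...,a and at least |N_j| / π⁻_j for each j = 1,...,b. -/
theorem stmt_3 (a b : ℕ) (ha : 1 ≤ a) (hb : 1 ≤ b) (P N : ℕ → ℝ)
    (hP : ∀ i ∈ Finset.Icc 1 a, 0 < P i)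
    (hPmono : ∀ i ∈ Finset.Icc 1 a, ∀ j ∈ Finset.Icc 1 a, i ≤ j → P i ≤ P j)
    (hN : ∀ i ∈ Finset.Icc 1 b, N i < 0)
    (hNmono : ∀ i ∈ Finset.Icc 1 b, ∀ j ∈ Finset.Icc 1 b, i ≤ j → |N i| ≤ |N j|)
    (hsum : ∑ l ∈ Finset.Icc 1 a, P l + ∑ l ∈ Finset.Icc 1 b, N l = 0)
    (y : ℕ → ℝ)
    (hy : (Finset.Icc 1 (a + b)).val.map y =
      (Finset.Icc 1 a).val.map P + (Finset.Icc 1 b).val.map N) :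
    (∀ j ∈ Finset.Icc 1 a,
      P j / ((j + ((Finset.range (b + 1)).filter
          (fun k => ∑ i ∈ Finset.Icc 1 k, |N i| ≤ ∑ l ∈ Finset.Icc 1 j, P l)).sup id : ℕ) : ℝ) ≤
        (Finset.Icc 1 (a + b)).sup' (Finset.nonempty_Icc.mpr (by omega))
            (fun j => (∑ k ∈ Finset.Icc 1 j, y k) / (j : ℝ)) -
        (Finset.Icc 1 (a + b)).inf' (Finset.nonempty_Icc.mpr (by omega))
            (fun j => (∑ k ∈ Finset.Icc 1 j, y k) / (j : ℝ))) ∧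
    (∀ j ∈ Finset.Icc 1 b,
      |N j| / ((j + ((Finset.range (a + 1)).filter
          (fun k => ∑ i ∈ Finset.Icc 1 k, P i < ∑ l ∈ Finset.Icc 1 j, |N l|)).sup id : ℕ) : ℝ) ≤
        (Finset.Icc 1 (a + b)).sup' (Finset.nonempty_Icc.mpr (by omega))
            (fun j => (∑ k ∈ Finset.Icc 1 j, y k) / (j : ℝ)) -
        (Finset.Icc 1 (a + b)).inf' (Finset.nonempty_Icc.mpr (by omega))
            (fun j => (∑ k ∈ Finset.Icc 1 j, y k) / (j : ℝ))) := by
  set U := (Finset.Icc 1 (a + b)).sup' (Finset.nonempty_Icc.mpr (by omega))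
    (fun j => (∑ k ∈ Finset.Icc 1 j, y k) / (j : ℝ))
  set L := (Finset.Icc 1 (a + b)).inf' (Finset.nonempty_Icc.mpr (by omega))
    (fun j => (∑ k ∈ Finset.Icc 1 j, y k) / (j : ℝ))
  have hU : ∀ m ∈ Finset.Icc 1 (a + b), (∑ i ∈ Finset.Icc 1 m, y i) / (m : ℝ) ≤ U :=
    fun m hm => Finset.le_sup' (fun j : ℕ => (∑ k ∈ Finset.Icc 1 j, y k) / (j : ℝ)) hm
  have hL : ∀ m ∈ Finset.Icc 1 (a + b), L ≤ (∑ i ∈ Finset.Icc 1 m, y i) / (m : ℝ) :=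
    fun m hm => Finset.inf'_le (fun j : ℕ => (∑ k ∈ Finset.Icc 1 j, y k) / (j : ℝ)) hm
  have htotal : ∑ i ∈ Finset.Icc 1 (a + b), y i = 0 := by
    have h := congrArg Multiset.sum hy
    rw [Multiset.sum_add] at h
    exact h.trans hsum
  have hab : a + b ∈ Finset.Icc 1 (a + b) := Finset.mem_Icc.mpr ⟨by omega, le_rfl⟩
  have hU0 : 0 ≤ U := by simpa [htotal] using hU _ hab
  have hL0 : L ≤ 0 := by simpa [htotal] using hL _ hab
  have hNabs : (Finset.Icc 1 b).val.map (fun i => -|N i|) = (Finset.Icc 1 b).val.map N :=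
    Multiset.map_congr rfl fun i hi => by rw [abs_of_neg (hN i hi), neg_neg]
  constructor
  · intro j hj
    refine div_le_sub_of_prefix_average_mem a b P (fun i => |N i|) y L U
      (fun i hi => (hP i hi).le) hPmono (fun i _ => abs_nonneg _) hNmono
      (by rw [hNabs]; exact hy) hL0 hU0 hL hU j _ hj (Finset.sup_le fun k hk => ?_) fun hle => ?_
    · have := Finset.mem_range.mp (Finset.mem_filter.mp hk).1
      simp only [id]
      omega
    · by_contra! hlt
      exact Nat.not_succ_le_self _ (Finset.le_sup (f := id)
        (Finset.mem_filter.mpr ⟨Finset.mem_range.mpr (Nat.lt_succ_of_le hle), hlt.le⟩))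
  · intro j hj
    have hyneg : (Finset.Icc 1 (b + a)).val.map (fun i => -y i) =
        (Finset.Icc 1 b).val.map (fun i => |N i|) + (Finset.Icc 1 a).val.map (fun i => -P i) := by
      have h := congrArg (Multiset.map Neg.neg) hy
      rw [← hNabs] at h
      simp only [Multiset.map_add, Multiset.map_map, Function.comp_def, neg_neg] at h
      rw [add_comm b a, h, add_comm]
    have hspan : U - L = -L - -U := by ring
    rw [hspan]
    refine div_le_sub_of_prefix_average_mem b a (fun i => |N i|) P (fun i => -y i) (-U) (-L)
      (fun i _ => abs_nonneg _) hNmono (fun i hi => (hP i hi).le) hPmono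
      hyneg (by linarith) (by linarith) (fun m hm => ?_) (fun m hm => ?_) j _ hj
      (Finset.sup_le fun k hk => ?_) fun hle => ?_
    · rw [Finset.sum_neg_distrib, neg_div]
      exact neg_le_neg (hU m (by rwa [add_comm a b]))
    · rw [Finset.sum_neg_distrib, neg_div]
      exact neg_le_neg (hL m (by rwa [add_comm a b]))
    · have := Finset.mem_range.mp (Finset.mem_filter.mp hk).1
      simp only [id]
      omega
    · by_contra! hlt
      exact Nat.not_succ_le_self _ (Finset.le_sup (f := id)
        (Finset.mem_filter.mpr ⟨Finset.mem_range.mpr (Nat.lt_succ_of_le hle), hlt⟩))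
end

section
/- For every integer μ ≥ 1 and every integer n ≥ 1 there exists a sequence of real midpoints m_1, ..., m_n such that (i) every real value occurs at most μ times among m_1, ..., m_n, (ii) any two distinct values occurring among m_1, ..., m_n differ by at least 1, and (iii) every prefix center of gravity C_j = (1/j)·Σ_{i=1}^{j} m_i (j = 1, ..., n) lies in the interval [0, 1/(1+μ)]. -/
open scoped Classical

/-- Load `μ` items at `0`, then, for `k = 1, 2, …`, load `μ` pairs at `k, -k`. -/
def alternatingLoad (μ i : ℕ) : ℤ :=
  if i ≤ μ then 0
  else if (i - 1 - μ) % 2 = 0 then (((i - 1 - μ) / 2 / μ + 1 : ℕ) : ℤ)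
  else -(((i - 1 - μ) / 2 / μ + 1 : ℕ) : ℤ)

lemma sum_alternatingLoad (μ j : ℕ) :
    ∑ i ∈ Finset.Icc 1 j, alternatingLoad μ i =
      if μ < j ∧ (j - 1 - μ) % 2 = 0 then (((j - 1 - μ) / 2 / μ + 1 : ℕ) : ℤ) else 0 := by
  induction j with
  | zero => simp
  | succ j ih =>
    rw [Finset.sum_Icc_succ_top (by omega), ih, alternatingLoad]
    by_cases h : j + 1 ≤ μ
    · rw [if_neg (by omega), if_pos h, if_neg (by omega), add_zero]
    rw [if_neg h]
    by_cases h2 : (j + 1 - 1 - μ) % 2 = 0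
    · rw [if_neg (by omega), if_pos h2, if_pos (by omega), zero_add]
    · have e : (j + 1 - 1 - μ) / 2 = (j - 1 - μ) / 2 := by omega
      rw [if_pos (by omega), if_neg h2, if_neg (by omega), e, add_neg_cancel]

lemma card_filter_alternatingLoad_le (μ n : ℕ) (hμ : 1 ≤ μ) (v : ℝ) :
    ((Finset.Icc 1 n).filter (fun i => (alternatingLoad μ i : ℝ) = v)).card ≤ μ := by
  conv_rhs => rw [← Finset.card_range μ]
  refine Finset.card_le_card_of_injOn
    (fun i => if i ≤ μ then i - 1 else (i - 1 - μ) / 2 % μ) ?_ ?_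
  · intro i hi
    simp only [Finset.coe_filter, Finset.mem_Icc, Set.mem_ofPred_eq] at hi
    simp only [Finset.coe_range, Set.mem_Iio]
    have := Nat.mod_lt ((i - 1 - μ) / 2) hμ
    split_ifs <;> omega
  · intro i hi j hj hij
    simp only [Finset.coe_filter, Finset.mem_Icc, Set.mem_ofPred_eq] at hi hj
    have hv : alternatingLoad μ i = alternatingLoad μ j := by
      exact_mod_cast hi.2.trans hj.2.symm
    have di := Nat.div_add_mod ((i - 1 - μ) / 2) μ
    have dj := Nat.div_add_mod ((j - 1 - μ) / 2) μ
    unfold alternatingLoad at hv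
    dsimp only at hij
    generalize (i - 1 - μ) / 2 / μ = p at *
    generalize (j - 1 - μ) / 2 / μ = q at *
    by_cases h1 : i ≤ μ <;> by_cases h2 : j ≤ μ <;>
      simp only [h1, h2, if_true, if_false] at hv hij
    · omega
    · split_ifs at hv <;> omega
    · split_ifs at hv <;> omega
    · have hq : p = q := by
        split_ifs at hv <;> omega
      have hw : (i - 1 - μ) / 2 = (j - 1 - μ) / 2 := by
        rw [← di, ← dj, hq, hij]
      split_ifs at hv <;> omega

lemma sum_alternatingLoad_nonneg (μ j : ℕ) :
    0 ≤ ∑ i ∈ Finset.Icc 1 j, alternatingLoad μ i := by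
  rw [sum_alternatingLoad]
  split_ifs <;> positivity

lemma sum_alternatingLoad_mul_le (μ j : ℕ) :
    (∑ i ∈ Finset.Icc 1 j, alternatingLoad μ i) * (1 + μ) ≤ j := by
  rw [sum_alternatingLoad]
  split_ifs with h
  · have h1 := Nat.mul_div_le ((j - 1 - μ) / 2) μ
    have h2 := Nat.div_le_self ((j - 1 - μ) / 2) μ
    have h3 : j = μ + 2 * ((j - 1 - μ) / 2) + 1 := by omega
    generalize (j - 1 - μ) / 2 = w at *
    generalize w / μ = q at *
    norm_cast
    nlinarith
  · simp

theorem stmt_6 (μ n : ℕ) (hμ : 1 ≤ μ) (hn : 1 ≤ n) :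
    ∃ m : ℕ → ℝ,
      (∀ v : ℝ, ((Finset.Icc 1 n).filter (fun i => m i = v)).card ≤ μ) ∧
      (∀ i ∈ Finset.Icc 1 n, ∀ j ∈ Finset.Icc 1 n, m i ≠ m j → 1 ≤ |m i - m j|) ∧
      (∀ j ∈ Finset.Icc 1 n,
        (∑ i ∈ Finset.Icc 1 j, m i) / (j : ℝ) ∈ Set.Icc (0 : ℝ) (1 / (1 + μ))) := by
  refine ⟨fun i => alternatingLoad μ i, card_filter_alternatingLoad_le μ n hμ, ?_, ?_⟩
  · intro i _ j _ hne
    dsimp only at hne ⊢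
    have hne' : alternatingLoad μ i - alternatingLoad μ j ≠ 0 :=
      fun h => hne (by exact_mod_cast sub_eq_zero.mp h)
    exact_mod_cast Int.one_le_abs hne'
  · intro j hj
    have hj0 : (0 : ℝ) < j := by exact_mod_cast (Finset.mem_Icc.mp hj).1
    have h0 : (0 : ℝ) ≤ ∑ i ∈ Finset.Icc 1 j, (alternatingLoad μ i : ℝ) := by
      exact_mod_cast sum_alternatingLoad_nonneg μ j
    have h1 : (∑ i ∈ Finset.Icc 1 j, (alternatingLoad μ i : ℝ)) * (1 + μ) ≤ j := by
      exact_mod_cast sum_alternatingLoad_mul_le μ j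
    refine ⟨div_nonneg h0 hj0.le, ?_⟩
    rw [div_le_div_iff₀ hj0 (by positivity), one_mul]
    exact h1
end

section
/- Let μ ≥ 1 and n > μ be integers. For every sequence of real midpoints m_1, ..., m_n such that every real value occurs at most μ times among m_1, ..., m_n and any two distinct values occurring among them differ by at least 1, the prefix centers of gravity C_0 = 0 and C_j = (1/j)·Σ_{i=1}^{j} m_i (j = 1, ..., n) satisfy max_{0 ≤ j ≤ n} C_j − min_{0 ≤ j ≤ n} C_j ≥ 1/(1+μ); i.e., no loading strategy for n > μ stackable unit items keeps all centers of gravity within an interval of length less than 1/(1+μ). -/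
open scoped Classical

/-- If the prefix averages `s k / k` and `s (k + 1) / (k + 1)` lie in `[a, b]`, the increment
`s (k + 1) - s k` lies in `[b - (k + 1) * (b - a), a + (k + 1) * (b - a)]`. -/
theorem increment_bounds_of_prefix_averages {s : ℕ → ℝ} (hs : s 0 = 0) {a b : ℝ} (k : ℕ)
    (h₀ : a ≤ s k / k ∧ s k / k ≤ b)
    (h₁ : a ≤ s (k + 1) / (k + 1 : ℕ) ∧ s (k + 1) / (k + 1 : ℕ) ≤ b) :
    b - (k + 1) * (b - a) ≤ s (k + 1) - s k ∧ s (k + 1) - s k ≤ a + (k + 1) * (b - a) := by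
  have lo_hi : a * k ≤ s k ∧ s k ≤ b * k := by
    rcases Nat.eq_zero_or_pos k with rfl | hk
    · simp [hs]
    · have hk' : (0 : ℝ) < k := by exact_mod_cast hk
      exact ⟨(le_div_iff₀ hk').mp h₀.1, (div_le_iff₀ hk').mp h₀.2⟩
  have hk' : (0 : ℝ) < (k + 1 : ℕ) := by positivity
  have lo := (le_div_iff₀ hk').mp h₁.1
  have hi := (div_le_iff₀ hk').mp h₁.2
  push_cast at lo hi
  constructor <;> linarith [lo_hi.1, lo_hi.2]

/-- For μ ≥ 1 and n > μ, every valid assignment of midpoints m_1, ..., m_n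
(each value occurring at most μ times, distinct values differing by at least 1) has
prefix centers of gravity (with C_0 = 0) spanning an interval of length at least
1/(1+μ). -/
theorem stmt_7 (μ n : ℕ) (hμ : 1 ≤ μ) (hn : μ < n) (m : ℕ → ℝ)
    (hstack : ∀ v : ℝ, ((Finset.Icc 1 n).filter (fun i => m i = v)).card ≤ μ)
    (hsep : ∀ i ∈ Finset.Icc 1 n, ∀ j ∈ Finset.Icc 1 n, m i ≠ m j → 1 ≤ |m i - m j|) :
    1 / (1 + (μ : ℝ)) ≤
      (Finset.Icc 0 n).sup' (Finset.nonempty_Icc.mpr (Nat.zero_le n))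
          (fun j => (∑ i ∈ Finset.Icc 1 j, m i) / (j : ℝ)) -
      (Finset.Icc 0 n).inf' (Finset.nonempty_Icc.mpr (Nat.zero_le n))
          (fun j => (∑ i ∈ Finset.Icc 1 j, m i) / (j : ℝ)) := by
  by_contra! hlt
  set C : ℕ → ℝ := fun j => (∑ i ∈ Finset.Icc 1 j, m i) / (j : ℝ) with hC
  set b := (Finset.Icc 0 n).sup' (Finset.nonempty_Icc.mpr (Nat.zero_le n)) C
  set a := (Finset.Icc 0 n).inf' (Finset.nonempty_Icc.mpr (Nat.zero_le n)) C
  have hab : ∀ j ≤ n, a ≤ C j ∧ C j ≤ b := fun j hj =>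
    have hmem : j ∈ Finset.Icc 0 n := Finset.mem_Icc.mpr ⟨Nat.zero_le j, hj⟩
    ⟨Finset.inf'_le C hmem, Finset.le_sup' C hmem⟩
  have hμ' : (0 : ℝ) < 1 + μ := by positivity
  rw [lt_div_iff₀ hμ'] at hlt
  have h₁ : a ≤ m 1 ∧ m 1 ≤ b := by simpa [hC] using hab 1 (by omega)
  have heq : ∀ j ∈ Finset.Icc 1 (μ + 1), m j = m 1 := by
    intro j hj
    obtain ⟨hj1, hj2⟩ := Finset.mem_Icc.mp hj
    by_contra hne
    have hdist := hsep j (Finset.mem_Icc.mpr ⟨hj1, by omega⟩) 1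
      (Finset.mem_Icc.mpr ⟨le_rfl, by omega⟩) hne
    obtain ⟨k, rfl⟩ : ∃ k, j = k + 1 := ⟨j - 1, by omega⟩
    have hinc := increment_bounds_of_prefix_averages
      (s := fun j => ∑ i ∈ Finset.Icc 1 j, m i) (by simp) k
      (hab k (by omega)) (hab (k + 1) (by omega))
    simp only [Finset.sum_Icc_succ_top hj1, add_sub_cancel_left] at hinc
    have hk : (k : ℝ) ≤ μ := by exact_mod_cast (by omega : k ≤ μ)
    have hL : ((k : ℝ) + 1) * (b - a) ≤ (b - a) * (1 + μ) := by
      rw [mul_comm, add_comm (k : ℝ)]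
      exact mul_le_mul_of_nonneg_left (by linarith) (by linarith)
    rcases le_abs.mp hdist with h | h <;> linarith
  have hsub : Finset.Icc 1 (μ + 1) ⊆ (Finset.Icc 1 n).filter (fun i => m i = m 1) := by
    intro j hj
    have hj' := Finset.mem_Icc.mp hj
    exact Finset.mem_filter.mpr ⟨Finset.mem_Icc.mpr ⟨hj'.1, by omega⟩, heq j hj⟩
  have hcard := (Finset.card_le_card hsub).trans (hstack (m 1))
  rw [Nat.card_Icc] at hcard
  omega
end

section
/- Let ℓ_1 ≥ ℓ_2 ≥ ... ≥ ℓ_n > 0 with n ≥ 2, and let I_1, ..., I_n be a connected plane placement of these lengths in any order: closed intervals with pairwise disjoint interiors, |I_j| equal to the lengths in some order, such that for every j the union I_1 ∪ ... ∪ I_j is an interval. Then the deviation Δ = max_{0 ≤ j ≤ n} |C_j| of the placement satisfies Δ ≥ ℓ_2 / 4, where ℓ_2 is the second-largest length. -/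
open Finset in
/-- An open interval disjoint from the interiors of finitely many closed intervals is disjoint from
the interior of their union. -/
lemma disjoint_Ioo_of_biUnion_Icc {ι : Type*} (s : Finset ι) (lo hi : ι → ℝ) {a b x y : ℝ}
    (hU : (⋃ i ∈ s, Set.Icc (lo i) (hi i)) = Set.Icc a b)
    (hdisj : ∀ i ∈ s, Disjoint (Set.Ioo (lo i) (hi i)) (Set.Ioo x y)) :
    Disjoint (Set.Ioo a b) (Set.Ioo x y) := by
  classical
  rw [Set.disjoint_iff_inter_eq_empty, Set.Ioo_inter_Ioo, Set.Ioo_eq_empty_iff]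
  intro hlt
  refine (Set.Ioo_infinite hlt) ((s.image lo ∪ s.image hi).finite_toSet.subset ?_)
  rintro z ⟨hz1, hz2⟩
  rw [sup_lt_iff] at hz1
  rw [lt_inf_iff] at hz2
  have hz : z ∈ ⋃ i ∈ s, Set.Icc (lo i) (hi i) := hU ▸ ⟨hz1.1.le, hz2.1.le⟩
  simp only [Set.mem_iUnion] at hz
  obtain ⟨i, hi', h1, h2⟩ := hz
  simp only [coe_union, coe_image, Set.mem_union, Set.mem_image, mem_coe]
  rcases h1.eq_or_lt with h1 | h1
  · exact Or.inl ⟨i, hi', h1⟩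
  rcases h2.eq_or_lt with h2 | h2
  · exact Or.inr ⟨i, hi', h2.symm⟩
  exact (Set.disjoint_left.mp (hdisj i hi') ⟨h1, h2⟩ ⟨hz1.2, hz2.2⟩).elim

/-- Two nondegenerate closed intervals with disjoint interiors whose union is an interval share an
endpoint. -/
lemma adjacent_of_Icc_union_Icc {a b x y c d : ℝ} (hab : a < b) (hxy : x < y)
    (hdisj : Disjoint (Set.Ioo a b) (Set.Ioo x y))
    (hU : Set.Icc a b ∪ Set.Icc x y = Set.Icc c d) : y = a ∨ x = b := by
  have mid {p q r s : ℝ} (hpq : p < q) (hrs : r < s) (hqr : q < r)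
      (h : Set.Icc p q ∪ Set.Icc r s = Set.Icc c d) : False := by
    have hq : q ∈ Set.Icc c d := h ▸ Or.inl ⟨hpq.le, le_rfl⟩
    have hr : r ∈ Set.Icc c d := h ▸ Or.inr ⟨le_rfl, hrs.le⟩
    have hm : (q + r) / 2 ∈ Set.Icc p q ∪ Set.Icc r s := by
      rw [h]
      constructor <;> linarith [hq.1, hr.2]
    rcases hm with hm | hm
    · linarith [hm.2]
    · linarith [hm.1]
  rw [Set.disjoint_iff_inter_eq_empty, Set.Ioo_inter_Ioo, Set.Ioo_eq_empty_iff, not_lt,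
    inf_le_iff, le_sup_iff, le_sup_iff] at hdisj
  rcases hdisj with (h | h) | (h | h)
  · linarith
  · exact Or.inr (h.eq_or_lt.resolve_right fun h => mid hab hxy h hU).symm
  · exact Or.inl (h.eq_or_lt.resolve_right fun h => mid hxy hab h (Set.union_comm _ _ ▸ hU))
  · linarith

/-- The union of two closed intervals sharing an endpoint, the second one lying to the left or to the
right, together with the additivity of length and of moment. -/
lemma exists_Icc_union_of_adjacent {a b x y : ℝ} (hab : a < b) (hxy : x < y)
    (h : y = a ∨ x = b) :
    ∃ a' b' : ℝ, a' < b' ∧ Set.Icc a b ∪ Set.Icc x y = Set.Icc a' b' ∧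
      b - a + (y - x) = b' - a' ∧
      (b ^ 2 - a ^ 2) / 2 + (y - x) * ((x + y) / 2) = (b' ^ 2 - a' ^ 2) / 2 ∧
      |(a' + b') / 2 - (a + b) / 2| = (y - x) / 2 := by
  rcases h with rfl | rfl
  · refine ⟨x, b, hxy.trans hab, ?_, by ring, by ring, ?_⟩
    · rw [Set.union_comm, Set.Icc_union_Icc_eq_Icc hxy.le hab.le]
    · rw [abs_of_nonpos] <;> linarith
  · refine ⟨a, y, hab.trans hxy, Set.Icc_union_Icc_eq_Icc hab.le hxy.le, by ring, by ring, ?_⟩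
    rw [abs_of_nonneg] <;> linarith

/-- The union of the first `j` intervals is `[a, b]`, with total length and moment those of
`[a, b]`. -/
structure IsPrefixHull (lo hi : ℕ → ℝ) (j : ℕ) (a b : ℝ) : Prop where
  lt : a < b
  union_eq : (⋃ i ∈ Finset.Icc 1 j, Set.Icc (lo i) (hi i)) = Set.Icc a b
  length_eq : ∑ i ∈ Finset.Icc 1 j, (hi i - lo i) = b - a
  moment_eq : ∑ i ∈ Finset.Icc 1 j, (hi i - lo i) * ((lo i + hi i) / 2) = (b ^ 2 - a ^ 2) / 2

lemma IsPrefixHull.centroid_eq {lo hi : ℕ → ℝ} {j : ℕ} {a b : ℝ} (h : IsPrefixHull lo hi j a b) :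
    (∑ i ∈ Finset.Icc 1 j, (hi i - lo i) * ((lo i + hi i) / 2)) /
      (∑ i ∈ Finset.Icc 1 j, (hi i - lo i)) = (a + b) / 2 := by
  have : b - a ≠ 0 := (sub_pos.mpr h.lt).ne'
  rw [h.moment_eq, h.length_eq]
  field_simp
  ring

/-- Adding one interval to a connected placement yields again a connected placement, and moves the
center by half the length of that interval. -/
lemma IsPrefixHull.exists_succ {lo hi : ℕ → ℝ} {j : ℕ} {a b : ℝ} (h : IsPrefixHull lo hi j a b)
    (hlt : lo (j + 1) < hi (j + 1))
    (hdisj : ∀ i ∈ Finset.Icc 1 j,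
      Disjoint (Set.Ioo (lo i) (hi i)) (Set.Ioo (lo (j + 1)) (hi (j + 1))))
    (hconn : ∃ c d : ℝ, (⋃ i ∈ Finset.Icc 1 (j + 1), Set.Icc (lo i) (hi i)) = Set.Icc c d) :
    ∃ a' b' : ℝ, IsPrefixHull lo hi (j + 1) a' b' ∧
      |(a' + b') / 2 - (a + b) / 2| = (hi (j + 1) - lo (j + 1)) / 2 := by
  obtain ⟨c, d, hcd⟩ := hconn
  have hunion : (⋃ i ∈ Finset.Icc 1 (j + 1), Set.Icc (lo i) (hi i)) =
      Set.Icc a b ∪ Set.Icc (lo (j + 1)) (hi (j + 1)) := by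
    rw [← Finset.insert_Icc_right_eq_Icc_add_one (by omega), Finset.set_biUnion_insert, h.union_eq,
      Set.union_comm]
  obtain ⟨a', b', hab', hU, hlen, hmom, hmove⟩ := exists_Icc_union_of_adjacent h.lt hlt
    (adjacent_of_Icc_union_Icc h.lt hlt (disjoint_Ioo_of_biUnion_Icc _ lo hi h.union_eq hdisj)
      (hunion ▸ hcd))
  refine ⟨a', b', ⟨hab', hunion.trans hU, ?_, ?_⟩, hmove⟩
  · rw [Finset.sum_Icc_succ_top (by omega), h.length_eq, hlen]
  · rw [Finset.sum_Icc_succ_top (by omega), h.moment_eq, hmom]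

/-- For lengths ℓ_1 ≥ ... ≥ ℓ_n > 0 (n ≥ 2), every connected plane
placement of these lengths (closed intervals with pairwise disjoint interiors whose
lengths are the given lengths in some order, every prefix union being an interval)
has deviation Δ = max_{0 ≤ j ≤ n} |C_j| at least ℓ_2 / 4. -/
theorem stmt_9 (n : ℕ) (hn : 2 ≤ n) (ℓ : ℕ → ℝ)
    (hpos : ∀ i ∈ Finset.Icc 1 n, 0 < ℓ i)
    (hanti : ∀ i ∈ Finset.Icc 1 n, ∀ j ∈ Finset.Icc 1 n, i ≤ j → ℓ j ≤ ℓ i)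
    (lo hi : ℕ → ℝ)
    (hle : ∀ j ∈ Finset.Icc 1 n, lo j ≤ hi j)
    (hdisj : ∀ i ∈ Finset.Icc 1 n, ∀ j ∈ Finset.Icc 1 n, i ≠ j →
      Disjoint (Set.Ioo (lo i) (hi i)) (Set.Ioo (lo j) (hi j)))
    (σ : ℕ → ℕ) (hσ : Set.BijOn σ (Set.Icc 1 n) (Set.Icc 1 n))
    (hlen : ∀ j ∈ Finset.Icc 1 n, hi j - lo j = ℓ (σ j))
    (hconn : ∀ j ∈ Finset.Icc 1 n, ∃ c d : ℝ,
      (⋃ i ∈ Finset.Icc 1 j, Set.Icc (lo i) (hi i)) = Set.Icc c d) :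
    ℓ 2 / 4 ≤
      (Finset.Icc 0 n).sup' (Finset.nonempty_Icc.mpr (Nat.zero_le n))
        (fun j => |(∑ i ∈ Finset.Icc 1 j, (hi i - lo i) * ((lo i + hi i) / 2)) /
          (∑ i ∈ Finset.Icc 1 j, (hi i - lo i))|) := by
  have hlt : ∀ j ∈ Finset.Icc 1 n, lo j < hi j := fun j hj => by
    have hσj := hσ.mapsTo (Finset.mem_Icc.mp hj)
    linarith [hlen j hj, hpos (σ j) (Finset.mem_Icc.mpr hσj)]
  have succ_step : ∀ j a b, 1 ≤ j → j + 1 ≤ n → IsPrefixHull lo hi j a b →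
      ∃ a' b' : ℝ, IsPrefixHull lo hi (j + 1) a' b' ∧
        |(a' + b') / 2 - (a + b) / 2| = (hi (j + 1) - lo (j + 1)) / 2 := by
    intro j a b hj hjn h
    have hmem : j + 1 ∈ Finset.Icc 1 n := Finset.mem_Icc.mpr ⟨by omega, hjn⟩
    refine h.exists_succ (hlt _ hmem) (fun i hij => ?_) (hconn _ hmem)
    rw [Finset.mem_Icc] at hij
    exact hdisj i (Finset.mem_Icc.mpr ⟨hij.1, by omega⟩) _ hmem (by omega)
  have hull : ∀ j, 1 ≤ j → j ≤ n → ∃ a b, IsPrefixHull lo hi j a b := by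
    intro j hj
    induction j, hj using Nat.le_induction with
    | base =>
      intro h1
      exact ⟨lo 1, hi 1, hlt 1 (Finset.mem_Icc.mpr ⟨le_rfl, h1⟩), by simp, by simp,
        by rw [Finset.Icc_self, Finset.sum_singleton]; ring⟩
    | succ j hj ih =>
      intro hjn
      obtain ⟨a, b, h⟩ := ih (by omega)
      obtain ⟨a', b', h', -⟩ := succ_step j a b hj hjn h
      exact ⟨a', b', h'⟩
  obtain ⟨j, hj, hjn, hbig⟩ : ∃ j, 1 ≤ j ∧ j + 1 ≤ n ∧ ℓ 2 ≤ hi (j + 1) - lo (j + 1) := by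
    have h1n : (1 : ℕ) ∈ Set.Icc 1 n := ⟨le_rfl, by omega⟩
    have h2n : (2 : ℕ) ∈ Set.Icc 1 n := ⟨by omega, hn⟩
    obtain ⟨p, hp, hp1⟩ := hσ.surjOn h1n
    obtain ⟨q, hq, hq2⟩ := hσ.surjOn h2n
    obtain ⟨k, hk, hk1, hkσ⟩ : ∃ k ∈ Set.Icc 1 n, k ≠ 1 ∧ σ k ≤ 2 := by
      by_cases h : p = 1
      · exact ⟨q, hq, by rintro rfl; subst h; omega, by omega⟩
      · exact ⟨p, hp, h, by omega⟩
    obtain ⟨hk0, hkn⟩ := hk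
    obtain ⟨j, rfl⟩ : ∃ j, k = j + 1 := ⟨k - 1, by omega⟩
    have hmem : j + 1 ∈ Finset.Icc 1 n := Finset.mem_Icc.mpr ⟨hk0, hkn⟩
    refine ⟨j, by omega, hkn, ?_⟩
    rw [hlen _ hmem]
    exact hanti _ (Finset.mem_Icc.mpr (hσ.mapsTo ⟨hk0, hkn⟩)) 2 (Finset.mem_Icc.mpr h2n) hkσ
  obtain ⟨a, b, h⟩ := hull j hj (by omega)
  obtain ⟨a', b', h', hmove⟩ := succ_step j a b hj hjn h
  rw [Finset.le_sup'_iff]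
  by_contra! hsmall
  have hC := hsmall j (Finset.mem_Icc.mpr ⟨by omega, by omega⟩)
  have hC' := hsmall (j + 1) (Finset.mem_Icc.mpr ⟨by omega, hjn⟩)
  rw [h.centroid_eq] at hC
  rw [h'.centroid_eq] at hC'
  linarith [abs_sub ((a' + b') / 2) ((a + b) / 2)]
end

section
/- Let ℓ_1 ≥ ℓ_2 ≥ ... ≥ ℓ_n > 0 with n ≥ 2. There exists a connected plane placement of these lengths, i.e., a sequence of closed intervals I_1, ..., I_n with pairwise disjoint interiors, with {|I_1|, ..., |I_n|} being the given multiset of lengths, such that every prefix union I_1 ∪ ... ∪ I_j is an interval and the deviation satisfies Δ = max_{0 ≤ j ≤ n} |C_j| ≤ ℓ_2 / 4. -/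
/-- The endpoints of the union of the first `j` intervals when each new interval of length `ℓ j` is
glued to the left end if the current center is nonnegative, and to the right end otherwise. -/
noncomputable def greedyEnds (ℓ : ℕ → ℝ) (p : ℝ) : ℕ → ℝ × ℝ
  | 0 => (p, p)
  | j + 1 =>
    let e := greedyEnds ℓ p j
    if 0 ≤ e.1 + e.2 then (e.1 - ℓ (j + 1), e.2) else (e.1, e.2 + ℓ (j + 1))

/-- The intervals `[lo j, hi j]`, for `1 ≤ j`, are glued one after the other to an end of the growing
interval `[a j, b j]`. -/
structure IsGluing (a b lo hi : ℕ → ℝ) : Prop where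
  zero : a 0 = b 0
  step : ∀ j, (lo (j + 1) = a (j + 1) ∧ hi (j + 1) = a j ∧ b (j + 1) = b j) ∨
    (lo (j + 1) = b j ∧ hi (j + 1) = b (j + 1) ∧ a (j + 1) = a j)

theorem exists_isGluing_greedyEnds (ℓ : ℕ → ℝ) (p : ℝ) :
    ∃ lo hi : ℕ → ℝ,
      IsGluing (fun j => (greedyEnds ℓ p j).1) (fun j => (greedyEnds ℓ p j).2) lo hi ∧
      ∀ j, hi (j + 1) - lo (j + 1) = ℓ (j + 1) := by
  have h : ∀ j, ∃ x y : ℝ,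
      ((x = (greedyEnds ℓ p (j + 1)).1 ∧ y = (greedyEnds ℓ p j).1 ∧
          (greedyEnds ℓ p (j + 1)).2 = (greedyEnds ℓ p j).2) ∨
        (x = (greedyEnds ℓ p j).2 ∧ y = (greedyEnds ℓ p (j + 1)).2 ∧
          (greedyEnds ℓ p (j + 1)).1 = (greedyEnds ℓ p j).1)) ∧ y - x = ℓ (j + 1) := by
    intro j
    by_cases hc : 0 ≤ (greedyEnds ℓ p j).1 + (greedyEnds ℓ p j).2
    · exact ⟨_, _, Or.inl ⟨rfl, rfl, by simp [greedyEnds, hc]⟩, by simp [greedyEnds, hc]⟩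
    · exact ⟨_, _, Or.inr ⟨rfl, rfl, by simp [greedyEnds, hc]⟩, by simp [greedyEnds, hc]⟩
  choose x y hxy using h
  exact ⟨fun j => x (j - 1), fun j => y (j - 1), ⟨rfl, fun j => (hxy j).1⟩, fun j => (hxy j).2⟩

/-- With steps `ℓ 2 ≥ ℓ 3 ≥ ...`, the center `(a + b) / 2` stays within `ℓ 2 / 4` of the origin,
because it is never too close to the origin for the next step. -/
theorem greedyEnds_center_bounds {n : ℕ} {ℓ : ℕ → ℝ} (hpos : ∀ i ∈ Finset.Icc 1 n, 0 < ℓ i)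
    (hanti : ∀ i ∈ Finset.Icc 1 n, ∀ j ∈ Finset.Icc 1 n, i ≤ j → ℓ j ≤ ℓ i) (j : ℕ)
    (hn : 2 ≤ n) (hj : j + 1 ≤ n) :
    let e := greedyEnds ℓ (ℓ 2 / 4 + ℓ 1 / 2) (j + 1)
    |e.1 + e.2| ≤ ℓ 2 / 2 ∧ (j + 2 ≤ n → ℓ (j + 2) - ℓ 2 / 2 ≤ |e.1 + e.2|) := by
  have h1 : 0 < ℓ 1 := hpos 1 (by simp; omega)
  have h2 : 0 < ℓ 2 := hpos 2 (by simp; omega)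
  induction j with
  | zero =>
    have hc : 0 ≤ ℓ 2 / 4 + ℓ 1 / 2 + (ℓ 2 / 4 + ℓ 1 / 2) := by linarith
    have he : ℓ 2 / 4 + ℓ 1 / 2 - ℓ 1 + (ℓ 2 / 4 + ℓ 1 / 2) = ℓ 2 / 2 := by ring
    simp only [greedyEnds, hc, if_true, he]
    rw [abs_of_pos (by linarith)]
    exact ⟨le_rfl, fun _ => by norm_num⟩
  | succ j ih =>
    obtain ⟨hu, hl⟩ := ih (by omega)
    replace hl := hl (by omega)
    have hle (hj' : j + 1 + 2 ≤ n) : ℓ (j + 1 + 2) ≤ ℓ (j + 2) :=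
      hanti _ (by simp; omega) _ (by simp; omega) (by omega)
    have hle2 : ℓ (j + 2) ≤ ℓ 2 := hanti _ (by simp; omega) _ (by simp; omega) (by omega)
    have h3 : 0 < ℓ (j + 2) := hpos _ (by simp; omega)
    rw [greedyEnds]
    dsimp only
    generalize greedyEnds ℓ (ℓ 2 / 4 + ℓ 1 / 2) (j + 1) = e at hu hl ⊢
    rw [show j + 1 + 1 = j + 2 from rfl]
    split_ifs with hc
    · rw [abs_of_nonneg hc] at hu hl
      exact ⟨abs_le.2 ⟨by linarith, by linarith⟩, fun hj' => le_abs.2 (Or.inr (by have := hle hj'; simp only; linarith))⟩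
    · rw [abs_of_neg (not_le.1 hc)] at hu hl
      exact ⟨abs_le.2 ⟨by simp only; linarith, by simp only; linarith⟩,
        fun hj' => le_abs.2 (Or.inl (by have := hle hj'; simp only; linarith))⟩

namespace IsGluing

variable {a b lo hi : ℕ → ℝ} {n : ℕ}

theorem ends_le (h : IsGluing a b lo hi) (hle : ∀ i ∈ Finset.Icc 1 n, lo i ≤ hi i) {j : ℕ}
    (hj : j ≤ n) : a j ≤ b j := by
  induction j with
  | zero => exact h.zero.le
  | succ j ih =>
    have := ih (by omega)
    have := hle (j + 1) (by simp; omega)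
    rcases h.step j with ⟨h1, h2, h3⟩ | ⟨h1, h2, h3⟩ <;> linarith

theorem ends_mem (h : IsGluing a b lo hi) (hle : ∀ i ∈ Finset.Icc 1 n, lo i ≤ hi i) {i j : ℕ}
    (hi1 : 1 ≤ i) (hij : i ≤ j) (hj : j ≤ n) : a j ≤ lo i ∧ hi i ≤ b j := by
  induction j, hij using Nat.le_induction with
  | base =>
    obtain ⟨i, rfl⟩ := Nat.exists_eq_add_of_le' hi1
    have := h.ends_le hle (j := i) (by omega)
    rcases h.step i with ⟨h1, h2, h3⟩ | ⟨h1, h2, h3⟩ <;> constructor <;> linarith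
  | succ j hij ih =>
    have := ih (by omega)
    have := hle (j + 1) (by simp; omega)
    rcases h.step j with ⟨h1, h2, h3⟩ | ⟨h1, h2, h3⟩ <;> constructor <;> linarith

theorem disjoint_of_lt (h : IsGluing a b lo hi) (hle : ∀ i ∈ Finset.Icc 1 n, lo i ≤ hi i)
    {i j : ℕ} (hi1 : 1 ≤ i) (hij : i < j) (hj : j ≤ n) :
    Disjoint (Set.Ioo (lo i) (hi i)) (Set.Ioo (lo j) (hi j)) := by
  obtain ⟨j, rfl⟩ := Nat.exists_eq_add_of_le' (show 1 ≤ j by omega)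
  have := h.ends_mem hle hi1 (show i ≤ j by omega) (by omega)
  rw [Set.disjoint_left]
  rintro x ⟨hx1, hx2⟩ ⟨hx3, hx4⟩
  rcases h.step j with ⟨h1, h2, h3⟩ | ⟨h1, h2, h3⟩ <;> linarith

theorem iUnion_Icc (h : IsGluing a b lo hi) (hle : ∀ i ∈ Finset.Icc 1 n, lo i ≤ hi i) {j : ℕ}
    (hj1 : 1 ≤ j) (hj : j ≤ n) :
    ⋃ i ∈ Finset.Icc 1 j, Set.Icc (lo i) (hi i) = Set.Icc (a j) (b j) := by
  induction j, hj1 using Nat.le_induction with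
  | base =>
    have := h.zero
    rcases h.step 0 with ⟨h1, h2, h3⟩ | ⟨h1, h2, h3⟩ <;> simp_all
  | succ j hj1 ih =>
    have hab := h.ends_le hle (j := j) (by omega)
    have hlh := hle (j + 1) (by simp; omega)
    rw [← Finset.insert_Icc_right_eq_Icc_add_one (by omega), Finset.set_biUnion_insert,
      ih (by omega)]
    rcases h.step j with ⟨h1, h2, h3⟩ | ⟨h1, h2, h3⟩
    · rw [h2, h1, h3, Set.Icc_union_Icc_eq_Icc (by linarith) hab]
    · rw [h2, h1, h3, Set.union_comm, Set.Icc_union_Icc_eq_Icc hab (by linarith)]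

theorem sum_length (h : IsGluing a b lo hi) (j : ℕ) :
    ∑ i ∈ Finset.Icc 1 j, (hi i - lo i) = b j - a j := by
  induction j with
  | zero => simp [h.zero]
  | succ j ih =>
    rw [Finset.sum_Icc_succ_top (by omega), ih]
    rcases h.step j with ⟨h1, h2, h3⟩ | ⟨h1, h2, h3⟩ <;> rw [h1, h2, h3] <;> ring

theorem sum_moment (h : IsGluing a b lo hi) (j : ℕ) :
    ∑ i ∈ Finset.Icc 1 j, (hi i - lo i) * ((lo i + hi i) / 2) =
      (b j - a j) * ((a j + b j) / 2) := by
  induction j with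
  | zero => simp [h.zero]
  | succ j ih =>
    rw [Finset.sum_Icc_succ_top (by omega), ih]
    rcases h.step j with ⟨h1, h2, h3⟩ | ⟨h1, h2, h3⟩ <;> rw [h1, h2, h3] <;> ring

end IsGluing


/-- For lengths ℓ_1 ≥ ... ≥ ℓ_n > 0 (n ≥ 2) there exists a connected
plane placement of these lengths (closed intervals with pairwise disjoint interiors,
lengths the given multiset, every prefix union an interval) whose deviation satisfies
max_{0 ≤ j ≤ n} |C_j| ≤ ℓ_2 / 4. -/
theorem stmt_10 (n : ℕ) (hn : 2 ≤ n) (ℓ : ℕ → ℝ)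
    (hpos : ∀ i ∈ Finset.Icc 1 n, 0 < ℓ i)
    (hanti : ∀ i ∈ Finset.Icc 1 n, ∀ j ∈ Finset.Icc 1 n, i ≤ j → ℓ j ≤ ℓ i) :
    ∃ lo hi : ℕ → ℝ,
      (∀ j ∈ Finset.Icc 1 n, lo j ≤ hi j) ∧
      (∀ i ∈ Finset.Icc 1 n, ∀ j ∈ Finset.Icc 1 n, i ≠ j →
        Disjoint (Set.Ioo (lo i) (hi i)) (Set.Ioo (lo j) (hi j))) ∧
      (∃ σ : ℕ → ℕ, Set.BijOn σ (Set.Icc 1 n) (Set.Icc 1 n) ∧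
        ∀ j ∈ Finset.Icc 1 n, hi j - lo j = ℓ (σ j)) ∧
      (∀ j ∈ Finset.Icc 1 n, ∃ c d : ℝ,
        (⋃ i ∈ Finset.Icc 1 j, Set.Icc (lo i) (hi i)) = Set.Icc c d) ∧
      (∀ j ∈ Finset.Icc 0 n,
        |(∑ i ∈ Finset.Icc 1 j, (hi i - lo i) * ((lo i + hi i) / 2)) /
          (∑ i ∈ Finset.Icc 1 j, (hi i - lo i))| ≤ ℓ 2 / 4) := by
  obtain ⟨lo, hi, hg, hlen⟩ := exists_isGluing_greedyEnds ℓ (ℓ 2 / 4 + ℓ 1 / 2)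
  have hlen' : ∀ j ∈ Finset.Icc 1 n, hi j - lo j = ℓ j := by
    intro j hj
    obtain ⟨j, rfl⟩ := Nat.exists_eq_add_of_le' (Finset.mem_Icc.1 hj).1
    exact hlen j
  have hle : ∀ j ∈ Finset.Icc 1 n, lo j ≤ hi j := fun j hj => by
    linarith [hpos j hj, hlen' j hj]
  refine ⟨lo, hi, hle, ?_, ⟨id, Set.bijOn_id _, hlen'⟩, ?_, ?_⟩
  · intro i hi j hj hij
    rw [Finset.mem_Icc] at hi hj
    rcases hij.lt_or_gt with hlt | hlt
    · exact hg.disjoint_of_lt hle hi.1 hlt hj.2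
    · exact (hg.disjoint_of_lt hle hj.1 hlt hi.2).symm
  · intro j hj
    rw [Finset.mem_Icc] at hj
    exact ⟨_, _, hg.iUnion_Icc hle hj.1 hj.2⟩
  · intro j hj
    have h2 : 0 < ℓ 2 := hpos 2 (by simp; omega)
    obtain _ | j := j
    · simpa using (div_pos h2 four_pos).le
    have hjn : j + 1 ≤ n := (Finset.mem_Icc.1 hj).2
    have hsum : 0 < ∑ i ∈ Finset.Icc 1 (j + 1), (hi i - lo i) :=
      Finset.sum_pos (fun i hi => by
        have hin : i ∈ Finset.Icc 1 n := Finset.Icc_subset_Icc_right hjn hi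
        rw [hlen' i hin]
        exact hpos i hin) ⟨1, by simp⟩
    rw [hg.sum_length] at hsum
    rw [hg.sum_moment, hg.sum_length, mul_div_cancel_left₀ _ hsum.ne', abs_div, abs_two]
    linarith [(greedyEnds_center_bounds hpos hanti j hn hjn).1]
end

section
/- Let n ≥ 4, x ≥ 2, ℓ > 0, and consider the exponential system of lengths ℓ, ℓx, ..., ℓx^{n−1}. Then every plane placement of these lengths (placed in any order, as closed intervals with pairwise disjoint interiors) has deviation Δ ≥ τ, where τ = (ℓ′ + ℓ″)·ℓ″ / (4·Σ_{i=1}^{n} ℓx^{i−1}) with ℓ′ = ℓx^{n−1} and ℓ″ = ℓx^{n−2}. -/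
/-- Intervals with disjoint interiors have midpoints at distance at least half their total length. -/
lemma half_add_length_le_abs_midpoint_sub {a b c d : ℝ} (hab : a < b) (hcd : c < d)
    (h : Disjoint (Set.Ioo a b) (Set.Ioo c d)) :
    ((b - a) + (d - c)) / 2 ≤ |(a + b) / 2 - (c + d) / 2| := by
  rw [Set.Ioo_disjoint_Ioo] at h
  rcases le_total b d with h₁ | h₁ <;> rcases le_total a c with h₂ | h₂ <;>
    simp only [min_eq_left, min_eq_right, max_eq_left, max_eq_right, h₁, h₂] at h <;>
    first
    | exact le_trans (by linarith) (le_abs_self _)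
    | exact le_trans (by linarith) (neg_le_abs _)

/-- A geometric sum of ratio at least `2` is at most twice its last term. -/
lemma sum_Icc_pow_pred_le {x : ℝ} (hx : 2 ≤ x) {n : ℕ} (hn : 1 ≤ n) :
    ∑ i ∈ Finset.Icc 1 n, x ^ (i - 1) ≤ 2 * x ^ (n - 1) := by
  induction n, hn using Nat.le_induction with
  | base => norm_num
  | succ k hk ih =>
    obtain ⟨m, rfl⟩ := Nat.exists_eq_add_of_le' hk
    rw [Finset.sum_Icc_succ_top (by omega)]
    have hpos : 0 ≤ x ^ m := by positivity
    simp only [Nat.add_sub_cancel, pow_succ] at ih ⊢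
    nlinarith

/-- If both `s / w` and `(s + w * m) / (w' + w)` have absolute value at most `D`, where
`w'` is the earlier weight, then `|m|` is bounded in terms of the weights. -/
lemma abs_mul_le_of_abs_le {s w w' m D : ℝ} (hw : 0 ≤ w) (hs : |s| ≤ D * w')
    (hs' : |s + w * m| ≤ D * (w' + w)) : |m| * w ≤ D * (2 * (w' + w) - w) := by
  calc |m| * w = |(s + w * m) - s| := by
        rw [add_sub_cancel_left, abs_mul, abs_of_nonneg hw, mul_comm]
    _ ≤ |s + w * m| + |s| := abs_sub _ _
    _ ≤ D * (2 * (w' + w) - w) := by linarith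

/-- For n ≥ 4, x ≥ 2, ℓ > 0, every plane placement of the exponential
system of lengths ℓ, ℓx, ..., ℓx^{n−1} (placed in any order as closed intervals with
pairwise disjoint interiors) has deviation Δ ≥ τ, where
τ = (ℓ′ + ℓ″)·ℓ″ / (4·Σ_i ℓx^{i−1}), ℓ′ = ℓx^{n−1}, ℓ″ = ℓx^{n−2}. -/
theorem stmt_11 (n : ℕ) (hn : 4 ≤ n) (x ℓ : ℝ) (hx : 2 ≤ x) (hℓ : 0 < ℓ)
    (lo hi : ℕ → ℝ)
    (hle : ∀ j ∈ Finset.Icc 1 n, lo j ≤ hi j)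
    (hdisj : ∀ i ∈ Finset.Icc 1 n, ∀ j ∈ Finset.Icc 1 n, i ≠ j →
      Disjoint (Set.Ioo (lo i) (hi i)) (Set.Ioo (lo j) (hi j)))
    (σ : ℕ → ℕ) (hσ : Set.BijOn σ (Set.Icc 1 n) (Set.Icc 1 n))
    (hlen : ∀ j ∈ Finset.Icc 1 n, hi j - lo j = ℓ * x ^ (σ j - 1)) :
    (ℓ * x ^ (n - 1) + ℓ * x ^ (n - 2)) * (ℓ * x ^ (n - 2)) /
        (4 * ∑ i ∈ Finset.Icc 1 n, ℓ * x ^ (i - 1)) ≤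
      (Finset.Icc 0 n).sup' (Finset.nonempty_Icc.mpr (Nat.zero_le n))
        (fun j => |(∑ i ∈ Finset.Icc 1 j, (hi i - lo i) * ((lo i + hi i) / 2)) /
          (∑ i ∈ Finset.Icc 1 j, (hi i - lo i))|) := by
  set D := (Finset.Icc 0 n).sup' (Finset.nonempty_Icc.mpr (Nat.zero_le n))
    (fun j => |(∑ i ∈ Finset.Icc 1 j, (hi i - lo i) * ((lo i + hi i) / 2)) /
      (∑ i ∈ Finset.Icc 1 j, (hi i - lo i))|)
  have hx0 : 0 < x := by linarith
  have hwpos : ∀ j ∈ Finset.Icc 1 n, 0 < hi j - lo j := fun j hj => by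
    rw [hlen j hj]; positivity
  set W : ℕ → ℝ := fun j => ∑ i ∈ Finset.Icc 1 j, (hi i - lo i) with hW
  set M : ℕ → ℝ := fun j => ∑ i ∈ Finset.Icc 1 j, (hi i - lo i) * ((lo i + hi i) / 2) with hM
  have hWmono : ∀ i j, i ≤ j → j ≤ n → W i ≤ W j := fun i j hij hj =>
    Finset.sum_le_sum_of_subset_of_nonneg (Finset.Icc_subset_Icc_right hij)
      fun k hk _ => (hwpos k (Finset.Icc_subset_Icc_right hj hk)).le
  have hWsucc : ∀ j, W (j + 1) = W j + (hi (j + 1) - lo (j + 1)) := fun j =>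
    Finset.sum_Icc_succ_top (by omega) _
  have hMsucc : ∀ j, M (j + 1) = M j + (hi (j + 1) - lo (j + 1)) *
      ((lo (j + 1) + hi (j + 1)) / 2) := fun j => Finset.sum_Icc_succ_top (by omega) _
  have hW0 : W 0 = 0 := by simp [hW]
  have hMle : ∀ j ≤ n, |M j| ≤ D * W j := by
    intro j hj
    rcases Nat.eq_zero_or_pos j with rfl | hj0
    · simp [hM, hW]
    have hWj : 0 < W j := Finset.sum_pos
      (fun k hk => hwpos k (Finset.Icc_subset_Icc_right hj hk)) (Finset.nonempty_Icc.mpr hj0)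
    have h : |M j / W j| ≤ D := Finset.le_sup' (fun j => |M j / W j|) (by simp [hj])
    rwa [abs_div, abs_of_pos hWj, div_le_iff₀ hWj] at h
  have hmid : ∀ j ∈ Finset.Icc 1 n, |(lo j + hi j) / 2| * (hi j - lo j) ≤
      D * (2 * W j - (hi j - lo j)) := by
    intro j hj
    obtain ⟨hj1, hjn⟩ := Finset.mem_Icc.mp hj
    obtain ⟨k, rfl⟩ := Nat.exists_eq_add_of_le' hj1
    rw [hWsucc]
    exact abs_mul_le_of_abs_le (hwpos _ hj).le (hMle k (by omega))
      (by rw [← hMsucc, ← hWsucc]; exact hMle _ hjn)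
  have hdist : ∀ i ∈ Finset.Icc 1 n, ∀ j ∈ Finset.Icc 1 n, i ≠ j →
      ((hi i - lo i) + (hi j - lo j)) / 2 ≤ |(lo i + hi i) / 2| + |(lo j + hi j) / 2| :=
    fun i hi₀ j hj hij => (half_add_length_le_abs_midpoint_sub (by linarith [hwpos i hi₀])
      (by linarith [hwpos j hj]) (hdisj i hi₀ j hj hij)).trans (abs_sub _ _)
  have hS : ∑ i ∈ Finset.Icc 1 n, ℓ * x ^ (i - 1) = W n := by
    refine (Finset.sum_nbij σ ?_ ?_ ?_ fun j hj => hlen j hj).symm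
    · exact fun j hj => Finset.mem_Icc.mpr (hσ.mapsTo (Finset.mem_Icc.mp hj))
    · simpa using hσ.injOn
    · simpa using hσ.surjOn
  have hS2 : W n ≤ 2 * (ℓ * x ^ (n - 1)) := by
    rw [← hS, ← Finset.mul_sum]
    nlinarith [sum_Icc_pow_pred_le hx (show 1 ≤ n by omega)]
  obtain ⟨p, hp, hpσ⟩ := hσ.surjOn (show n ∈ Set.Icc 1 n from ⟨by omega, le_rfl⟩)
  obtain ⟨q, hq, hqσ⟩ := hσ.surjOn (show n - 1 ∈ Set.Icc 1 n from ⟨by omega, by omega⟩)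
  rw [← Finset.coe_Icc, Finset.mem_coe] at hp hq
  have hpq : p ≠ q := by rintro rfl; omega
  have hlp : hi p - lo p = ℓ * x ^ (n - 1) := by rw [hlen p hp, hpσ]
  have hlq : hi q - lo q = ℓ * x ^ (n - 2) := by rw [hlen q hq, hqσ, Nat.sub_sub]
  rw [hS, ← hlp, ← hlq]
  have hab : 2 * (hi q - lo q) ≤ hi p - lo p := by
    rw [hlp, hlq, show n - 1 = n - 2 + 1 by omega, pow_succ]
    nlinarith [show 0 < ℓ * x ^ (n - 2) by positivity]
  rw [← hlp] at hS2
  have hap := hwpos p hp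
  have hbp := hwpos q hq
  have hmp := hmid p hp
  have hmq := hmid q hq
  have hd := hdist p hp q hq hpq
  obtain ⟨hp1, hpn⟩ := Finset.mem_Icc.mp hp
  obtain ⟨hq1, hqn⟩ := Finset.mem_Icc.mp hq
  have hWp := hWmono p n hpn le_rfl
  have hWq := hWmono q n hqn le_rfl
  have hsum : (hi p - lo p) + (hi q - lo q) ≤ W n := by
    rw [← Finset.sum_pair (f := fun i => hi i - lo i) hpq]
    refine Finset.sum_le_sum_of_subset_of_nonneg ?_ fun k hk _ => (hwpos k hk).le
    simp [Finset.insert_subset_iff, hp1, hpn, hq1, hqn]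
  have hD0 : 0 ≤ D := le_trans (abs_nonneg _) (Finset.le_sup' (fun j => |M j / W j|)
    (Finset.mem_Icc.mpr ⟨le_rfl, Nat.zero_le n⟩))
  have hpW3 : |(lo p + hi p) / 2| ≤ 3 * D := by
    refine le_of_mul_le_mul_right ?_ hap
    nlinarith
  rw [div_le_iff₀ (by linarith)]
  rcases lt_or_gt_of_ne hpq with hlt | hgt
  · rcases hp1.eq_or_lt with rfl | hp2
    · have hW1 : W 1 = hi 1 - lo 1 := by simpa [hW0] using hWsucc 0
      have hm1 : |(lo 1 + hi 1) / 2| ≤ D := by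
        refine le_of_mul_le_mul_right ?_ hap
        rw [hW1] at hmp; linarith
      nlinarith [mul_le_mul_of_nonneg_left hWq hD0, mul_le_mul_of_nonneg_right hd hbp.le,
        mul_le_mul_of_nonneg_right hm1 hbp.le]
    · have h1 : 1 ∈ Finset.Icc 1 n := Finset.mem_Icc.mpr ⟨le_rfl, by omega⟩
      have hm := hmid 1 h1
      have hW1 : W 1 = hi 1 - lo 1 := by simpa [hW0] using hWsucc 0
      have hm1 : |(lo 1 + hi 1) / 2| ≤ D := by
        refine le_of_mul_le_mul_right ?_ (hwpos 1 h1)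
        rw [hW1] at hm; linarith
      have hd1 := hdist p hp 1 h1 (by omega)
      have hbD : hi q - lo q ≤ 4 * D := by linarith [hwpos 1 h1]
      nlinarith [mul_le_mul hsum hbD hbp.le (by linarith)]
  · have hWqp : W q + (hi p - lo p) ≤ W n := by
      obtain ⟨k, rfl⟩ := Nat.exists_eq_add_of_le' hp1
      linarith [hWmono q k (by omega) (by omega), hWsucc k]
    nlinarith [mul_le_mul_of_nonneg_left hWqp hD0, mul_le_mul_of_nonneg_right hd hbp.le,
      mul_le_mul_of_nonneg_right hpW3 hbp.le, mul_le_mul_of_nonneg_left hab hD0]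
end

section
/- Let n ≥ 4, x ≥ 2, ℓ > 0, and consider the exponential system of lengths ℓ, ℓx, ..., ℓx^{n−1}. There exists a plane placement of these lengths (the lengths placed in some order as closed intervals with pairwise disjoint interiors) whose deviation satisfies Δ ≤ τ, where τ = (ℓ′ + ℓ″)·ℓ″ / (4·Σ_{i=1}^{n} ℓx^{i−1}) with ℓ′ = ℓx^{n−1} and ℓ″ = ℓx^{n−2}. -/
open Finset

/-- Intervals of lengths `w j` centred at `m j - τ` form a placement of deviation at most `τ`
once they are separated and the moments of the unshifted prefixes are between `0` and `2 * τ`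
times the mass. -/
theorem exists_placement_of_moments {n : ℕ} {w m : ℕ → ℝ} {τ : ℝ} (hτ : 0 ≤ τ)
    (hw : ∀ j ∈ Icc 1 n, 0 < w j)
    (hsep : ∀ i ∈ Icc 1 n, ∀ j ∈ Icc 1 n, i ≠ j →
      m i + w i / 2 ≤ m j - w j / 2 ∨ m j + w j / 2 ≤ m i - w i / 2)
    (hmom : ∀ j ∈ Icc 1 n, 0 ≤ ∑ i ∈ Icc 1 j, w i * m i ∧
      ∑ i ∈ Icc 1 j, w i * m i ≤ 2 * τ * ∑ i ∈ Icc 1 j, w i) :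
    ∃ lo hi : ℕ → ℝ,
      (∀ j ∈ Icc 1 n, lo j ≤ hi j) ∧
      (∀ i ∈ Icc 1 n, ∀ j ∈ Icc 1 n, i ≠ j →
        Disjoint (Set.Ioo (lo i) (hi i)) (Set.Ioo (lo j) (hi j))) ∧
      (∀ j, hi j - lo j = w j) ∧
      (∀ j ∈ Icc 0 n,
        |(∑ i ∈ Icc 1 j, (hi i - lo i) * ((lo i + hi i) / 2)) /
            (∑ i ∈ Icc 1 j, (hi i - lo i))| ≤ τ) := by
  have hlen : ∀ j, (m j + w j / 2 - τ) - (m j - w j / 2 - τ) = w j := fun j => by ring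
  refine ⟨fun j => m j - w j / 2 - τ, fun j => m j + w j / 2 - τ, ?_, ?_, hlen, ?_⟩
  · intro j hj
    have := hw j hj
    linarith
  · intro i hi j hj hij
    rw [Set.disjoint_left]
    rintro y ⟨h1, h2⟩ ⟨h3, h4⟩
    rcases hsep i hi j hj hij with h | h <;> linarith
  · intro j hj
    have hmid : ∀ i, (m i - w i / 2 - τ + (m i + w i / 2 - τ)) / 2 = m i - τ := fun i => by ring
    simp only [hlen, hmid, mul_sub, sum_sub_distrib, ← sum_mul]
    rcases Nat.eq_zero_or_pos j with rfl | hj0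
    · simpa using hτ
    · have hjn : j ≤ n := (mem_Icc.1 hj).2
      have hW : 0 < ∑ i ∈ Icc 1 j, w i := by
        refine sum_pos (fun i hi => hw i ?_) ⟨1, by simp; omega⟩
        rw [mem_Icc] at hi ⊢
        omega
      obtain ⟨h0, h1⟩ := hmom j (mem_Icc.2 ⟨hj0, hjn⟩)
      rw [abs_le, le_div_iff₀ hW, div_le_iff₀ hW]
      constructor <;> linarith

/-- The order in which the lengths are placed: first the largest one, then those with exponents
`k`, `k + 1`, then the smaller ones increasingly, and finally the second largest one. -/
def placementOrder (k j : ℕ) : ℕ :=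
  if j = 1 then k + 4 else if j = 2 then k + 1 else if j = 3 then k + 2
  else if j = k + 4 then k + 3 else j - 3

theorem placementOrder_bijOn (k : ℕ) :
    Set.BijOn (placementOrder k) (Set.Icc 1 (k + 4)) (Set.Icc 1 (k + 4)) := by
  refine ⟨fun j hj => ?_, fun i hi j hj hij => ?_, fun y hy => ?_⟩
  · simp only [Set.mem_Icc, placementOrder] at hj ⊢
    split_ifs <;> omega
  · simp only [Set.mem_Icc, placementOrder] at hi hj hij
    split_ifs at hij <;> omega
  · refine ⟨if y = k + 4 then 1 else if y = k + 1 then 2 else if y = k + 2 then 3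
      else if y = k + 3 then k + 4 else y + 3, ?_, ?_⟩
    · simp only [Set.mem_Icc] at hy ⊢
      split_ifs <;> omega
    · simp only [Set.mem_Icc] at hy
      simp only [placementOrder]
      split_ifs <;> omega

theorem sum_Icc_one_add_three (f : ℕ → ℝ) (p : ℕ) :
    ∑ i ∈ Icc 1 (p + 3), f i = f 1 + f 2 + f 3 + ∑ i ∈ range p, f (i + 4) := by
  induction p with
  | zero => simp [sum_Icc_succ_top]
  | succ p ih =>
    rw [show p + 1 + 3 = (p + 3) + 1 by ring, sum_Icc_succ_top (by omega), ih, sum_range_succ]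
    ring

theorem sub_one_mul_sum_geom_le {x ℓ : ℝ} (hℓ : 0 < ℓ) (p : ℕ) :
    (x - 1) * ∑ i ∈ range p, ℓ * x ^ i ≤ ℓ * x ^ p := by
  rw [← mul_sum]
  have := geom_sum_mul x p
  nlinarith

theorem mul_pow_le_quarter {x ℓ : ℝ} (hx : 2 ≤ x) (hℓ : 0 < ℓ) {i k : ℕ} (hi : i + 1 < k) :
    ℓ * x ^ i ≤ ℓ * x ^ k / 4 := by
  have h1 : x ^ (i + 2) ≤ x ^ k := pow_le_pow_right₀ (by linarith) hi
  have h2 : x ^ i * 4 ≤ x ^ i * x ^ 2 := mul_le_mul_of_nonneg_left (by nlinarith) (by positivity)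
  rw [pow_add] at h1
  have := mul_le_mul_of_nonneg_left (h2.trans h1) hℓ.le
  linarith

theorem two_mul_pow_le {x ℓ : ℝ} (hx : 2 ≤ x) (hℓ : 0 < ℓ) {i j : ℕ} (hij : i < j) :
    2 * (ℓ * x ^ i) ≤ ℓ * x ^ j := by
  have h1 : x ^ (i + 1) ≤ x ^ j := pow_le_pow_right₀ (by linarith) hij
  have h2 : x ^ i * 2 ≤ x ^ i * x := mul_le_mul_of_nonneg_left hx (by positivity)
  rw [pow_succ] at h1
  have := mul_le_mul_of_nonneg_left (h2.trans h1) hℓ.le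
  linarith

theorem pow_growth {x : ℝ} (hx : 2 ≤ x) :
    4 ≤ x ^ 2 ∧ 2 * x ≤ x ^ 2 ∧ 2 * x ^ 2 ≤ x ^ 3 ∧ 2 * x ^ 3 ≤ x ^ 4 ∧ 2 * x ^ 4 ≤ x ^ 5 := by
  have h : ∀ n, 2 * x ^ n ≤ x ^ (n + 1) := fun n => by
    rw [pow_succ, mul_comm]
    exact mul_le_mul_of_nonneg_left hx (by positivity)
  exact ⟨by nlinarith, by simpa using h 1, h 2, h 3, h 4⟩

/-- Separation of the intervals: the smallest lengths sit just to the right of the gap left for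
the second largest one, the last of them and the third largest one to the left. -/
theorem separated_of_midpoints {k : ℕ} {x ℓ u c : ℝ} {w m : ℕ → ℝ} (hx : 2 ≤ x) (hℓ : 0 < ℓ)
    (hu : u = ℓ * x ^ k) (hc : c = u * x ^ 3 / 2 + u * x ^ 2)
    (hw1 : w 1 = u * x ^ 3) (hm1 : m 1 = 0)
    (hw2 : w 2 = u) (hm2 : c + u ≤ m 2 - u / 2)
    (hw3 : w 3 = u * x) (hm3 : m 3 = -(u * x ^ 3 + u * x) / 2)
    (hwn : w (k + 4) = u * x ^ 2) (hmn : m (k + 4) = (u * x ^ 3 + u * x ^ 2) / 2)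
    (hml : 0 < k → m (k + 3) + w (k + 3) / 2 ≤ -(u * x ^ 3 / 2 + u * x))
    (hwi : ∀ i < k, w (i + 4) = ℓ * x ^ i)
    (hmi : ∀ i, i + 1 < k → m (i + 4) = c + 3 / 2 * w (i + 4)) :
    ∀ i ∈ Icc 1 (k + 4), ∀ j ∈ Icc 1 (k + 4), i ≠ j →
      m i + w i / 2 ≤ m j - w j / 2 ∨ m j + w j / 2 ≤ m i - w i / 2 := by
  have hx0 : 0 < x := by linarith
  have hu0 : 0 < u := by rw [hu]; positivity
  have hux : 0 < u * x := by positivity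
  have hux2 : 0 < u * x ^ 2 := by positivity
  have hux3 : 0 < u * x ^ 3 := by positivity
  have hpos : ∀ i, 0 < ℓ * x ^ i := fun i => by positivity
  have key : ∀ j ∈ Icc 1 (k + 4),
      (j = 1 ∧ m j = 0 ∧ w j = u * x ^ 3) ∨ (j = 2 ∧ c + u ≤ m j - u / 2 ∧ w j = u) ∨
      (j = 3 ∧ m j = -(u * x ^ 3 + u * x) / 2 ∧ w j = u * x) ∨
      (j = k + 4 ∧ m j = (u * x ^ 3 + u * x ^ 2) / 2 ∧ w j = u * x ^ 2) ∨
      (j = k + 3 ∧ m j + w j / 2 ≤ -(u * x ^ 3 / 2 + u * x)) ∨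
      (∃ i, i + 1 < k ∧ j = i + 4 ∧ m j = c + 3 / 2 * w j ∧ w j = ℓ * x ^ i) := by
    intro j hj
    rw [mem_Icc] at hj
    by_cases h1 : j = 1
    · subst h1; exact Or.inl ⟨rfl, hm1, hw1⟩
    by_cases h2 : j = 2
    · subst h2; exact Or.inr (Or.inl ⟨rfl, hm2, hw2⟩)
    by_cases h3 : j = 3
    · subst h3; exact Or.inr (Or.inr (Or.inl ⟨rfl, hm3, hw3⟩))
    by_cases h4 : j = k + 4
    · subst h4; exact Or.inr (Or.inr (Or.inr (Or.inl ⟨rfl, hmn, hwn⟩)))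
    by_cases h5 : j = k + 3
    · subst h5
      exact Or.inr (Or.inr (Or.inr (Or.inr (Or.inl ⟨rfl, hml (by omega)⟩))))
    · obtain ⟨i, rfl⟩ : ∃ i, j = i + 4 := ⟨j - 4, by omega⟩
      exact Or.inr (Or.inr (Or.inr (Or.inr (Or.inr
        ⟨i, by omega, rfl, hmi i (by omega), hwi i (by omega)⟩))))
  have hsmall : ∀ i, i + 1 < k → ℓ * x ^ i ≤ u / 4 := fun i hi => by
    rw [hu]; exact mul_pow_le_quarter hx hℓ hi
  clear hw1 hm1 hw2 hm2 hw3 hm3 hwn hmn hml hwi hmi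
  intro i hi j hj hij
  rcases key i hi with ⟨ei, a1, a2⟩ | ⟨ei, a1, a2⟩ | ⟨ei, a1, a2⟩ | ⟨ei, a1, a2⟩ | ⟨ei, a1⟩ |
      ⟨p, hp, ei, a1, a2⟩ <;>
    rcases key j hj with ⟨ej, b1, b2⟩ | ⟨ej, b1, b2⟩ | ⟨ej, b1, b2⟩ | ⟨ej, b1, b2⟩ | ⟨ej, b1⟩ |
      ⟨q, hq, ej, b1, b2⟩
  all_goals clear key
  all_goals first
    | (exfalso; omega)
    | (left; linarith)
    | (right; linarith)
    | (have := hsmall p hp; have := hpos p; left; linarith)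
    | (have := hsmall p hp; have := hpos p; right; linarith)
    | (have := hsmall q hq; have := hpos q; left; linarith)
    | (have := hsmall q hq; have := hpos q; right; linarith)
    | (rcases lt_or_gt_of_ne (show p ≠ q by omega) with h | h
       · left; have := two_mul_pow_le hx hℓ h; linarith
       · right; have := two_mul_pow_le hx hℓ h; linarith)

theorem sum_small_moments_le {x ℓ c : ℝ} (hx : 2 ≤ x) (hℓ : 0 < ℓ) (hc : 0 ≤ c) {p k : ℕ}
    (hp : p < k) :
    ∑ i ∈ range p, ℓ * x ^ i * (c + 3 / 2 * (ℓ * x ^ i)) ≤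
      ℓ * x ^ k / 2 * (c + ℓ * x ^ k) := by
  have hx0 : 0 < x := by linarith
  have hle : ∑ i ∈ range p, ℓ * x ^ i * (c + 3 / 2 * (ℓ * x ^ i)) ≤
      (∑ i ∈ range p, ℓ * x ^ i) * (c + ℓ * x ^ k) := by
    rw [sum_mul]
    refine sum_le_sum fun i hi => ?_
    have h1 := mul_pow_le_quarter hx hℓ (show i + 1 < k by rw [mem_range] at hi; omega)
    have h2 : 0 < ℓ * x ^ i := by positivity
    exact mul_le_mul_of_nonneg_left (by linarith) h2.le
  have hT : ∑ i ∈ range p, ℓ * x ^ i ≤ ℓ * x ^ k / 2 := by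
    have h1 := sub_one_mul_sum_geom_le (x := x) hℓ p
    have h2 : 0 ≤ ∑ i ∈ range p, ℓ * x ^ i := sum_nonneg fun i _ => by positivity
    have h3 := two_mul_pow_le hx hℓ hp
    nlinarith
  exact hle.trans (mul_le_mul_of_nonneg_right hT (by positivity))

/-- The moments of all prefixes lie between `0` and `2 * τ` times the mass. -/
theorem moments_of_midpoints {k : ℕ} {x ℓ u c E τ : ℝ} {w m : ℕ → ℝ} (hx : 2 ≤ x) (hℓ : 0 < ℓ)
    (hu : u = ℓ * x ^ k) (hc : c = u * x ^ 3 / 2 + u * x ^ 2)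
    (hE0 : 0 ≤ E) (hE : E ≤ u ^ 2 * (x ^ 3 / 4 + x / 2 + 1 / 8)) (hEk : k = 0 → E = 0)
    (hw1 : w 1 = u * x ^ 3) (hm1 : m 1 = 0)
    (hw2 : w 2 = u) (hm2 : u * m 2 = u * x * (u * x ^ 3 + u * x) / 2 + E)
    (hw3 : w 3 = u * x) (hm3 : m 3 = -(u * x ^ 3 + u * x) / 2)
    (hwn : w (k + 4) = u * x ^ 2) (hmn : m (k + 4) = (u * x ^ 3 + u * x ^ 2) / 2)
    (hwi : ∀ i < k, w (i + 4) = ℓ * x ^ i)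
    (hmi : ∀ i, i + 1 < k → m (i + 4) = c + 3 / 2 * w (i + 4))
    (hml : 0 < k → w (k + 3) * m (k + 3) =
      -(E + ∑ i ∈ range (k - 1), ℓ * x ^ i * (c + 3 / 2 * (ℓ * x ^ i))))
    (hτ : 4 * τ * ∑ i ∈ Icc 1 (k + 4), ℓ * x ^ (i - 1) =
      (ℓ * x ^ (k + 3) + ℓ * x ^ (k + 2)) * (ℓ * x ^ (k + 2))) :
    ∀ j ∈ Icc 1 (k + 4), 0 ≤ ∑ i ∈ Icc 1 j, w i * m i ∧
      ∑ i ∈ Icc 1 j, w i * m i ≤ 2 * τ * ∑ i ∈ Icc 1 j, w i := by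
  have hx0 : 0 < x := by linarith
  have hu0 : 0 < u := by rw [hu]; positivity
  have hc0 : 0 < c := by rw [hc]; positivity
  obtain ⟨hx2, hx2', hx3, hx4, hx5⟩ := pow_growth hx
  have hT := sub_one_mul_sum_geom_le (x := x) hℓ k
  rw [← hu] at hT
  have hpos : ∀ p, 0 ≤ ∑ i ∈ range p, ℓ * x ^ i := fun p => sum_nonneg fun i _ => by positivity
  have hL : ∑ i ∈ Icc 1 (k + 4), ℓ * x ^ (i - 1) =
      (∑ i ∈ range k, ℓ * x ^ i) + u + u * x + u * x ^ 2 + u * x ^ 3 := by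
    have : ∀ n : ℕ, ∑ i ∈ Icc 1 n, ℓ * x ^ (i - 1) = ∑ i ∈ range n, ℓ * x ^ i := by
      intro n
      induction n with
      | zero => simp
      | succ n ih => rw [sum_Icc_succ_top (by omega), ih, sum_range_succ]; simp
    rw [this]
    simp only [sum_range_succ, hu]
    ring
  have hτ' : 2 * τ * (∑ i ∈ range k, ℓ * x ^ i + u + u * x + u * x ^ 2 + u * x ^ 3) =
      (u * x ^ 3 + u * x ^ 2) * (u * x ^ 2) / 2 := by
    rw [← hL, show u * x ^ 3 = ℓ * x ^ (k + 3) by rw [hu]; ring,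
      show u * x ^ 2 = ℓ * x ^ (k + 2) by rw [hu]; ring]
    linarith
  have hτu : u * (x ^ 2 - 1) / 2 ≤ 2 * τ := by
    have hLpos : 0 < ∑ i ∈ range k, ℓ * x ^ i + u + u * x + u * x ^ 2 + u * x ^ 3 := by
      have := hpos k
      positivity
    refine le_of_mul_le_mul_right ?_ hLpos
    rw [hτ']
    have h2 : (x - 1) * (∑ i ∈ range k, ℓ * x ^ i + u + u * x + u * x ^ 2 + u * x ^ 3) ≤
        u * x ^ 4 := by linarith
    have := mul_le_mul_of_nonneg_left h2 (show 0 ≤ u * (x + 1) / 2 by positivity)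
    linarith
  have hτ0 : 0 ≤ 2 * τ := le_trans (div_nonneg (mul_nonneg hu0.le (by linarith)) (by norm_num)) hτu
  have hbase : u ^ 2 * ((x ^ 2 - 1) * (x ^ 3 + 1) / 2) ≤ 2 * τ * (u * x ^ 3 + u) := by
    have := mul_le_mul_of_nonneg_right hτu (show 0 ≤ u * x ^ 3 + u by positivity)
    linarith
  have hg0 : ∀ p, 0 ≤ ∑ i ∈ range p, ℓ * x ^ i * (c + 3 / 2 * (ℓ * x ^ i)) := fun p =>
    sum_nonneg fun i _ => by positivity
  have hS : ∀ p, p < k ∨ p = 0 → ∑ i ∈ Icc 1 (p + 3), w i * m i =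
      E + ∑ i ∈ range p, ℓ * x ^ i * (c + 3 / 2 * (ℓ * x ^ i)) := by
    intro p hp
    have h : ∑ i ∈ range p, w (i + 4) * m (i + 4) =
        ∑ i ∈ range p, ℓ * x ^ i * (c + 3 / 2 * (ℓ * x ^ i)) := by
      refine sum_congr rfl fun i hi => ?_
      rw [mem_range] at hi
      rw [hmi i (by omega), hwi i (by omega)]
    rw [sum_Icc_one_add_three, h, hw1, hm1, hw2, hm2, hw3, hm3]
    ring
  have hW : ∀ p ≤ k, ∑ i ∈ Icc 1 (p + 3), w i =
      u * x ^ 3 + u + u * x + ∑ i ∈ range p, ℓ * x ^ i := by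
    intro p hp
    have h : ∑ i ∈ range p, w (i + 4) = ∑ i ∈ range p, ℓ * x ^ i := by
      refine sum_congr rfl fun i hi => hwi i ?_
      rw [mem_range] at hi
      omega
    rw [sum_Icc_one_add_three, h, hw1, hw2, hw3]
  have hlast : ∑ i ∈ Icc 1 (k + 3), w i * m i = 0 := by
    rcases Nat.eq_zero_or_pos k with h0 | hk
    · rw [hS k (Or.inr h0), hEk h0, h0]
      simp
    · have h1 := hS (k - 1) (Or.inl (by omega))
      rw [show k - 1 + 3 = k + 2 by omega] at h1
      rw [show k + 3 = (k + 2) + 1 by ring, sum_Icc_succ_top (by omega), h1, hml hk]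
      ring
  have hsecond : u * m 2 ≤ 2 * τ * (u * x ^ 3 + u) := by
    have : 0 ≤ u ^ 2 *
        ((x ^ 2 - 1) * (x ^ 3 + 1) / 2 - (x ^ 3 / 4 + x / 2 + 1 / 8) - (x ^ 4 + x ^ 2) / 2) := by
      apply mul_nonneg (by positivity)
      linarith
    rw [hm2]
    linarith
  have hsmall : ∀ p, p < k ∨ p = 0 →
      E + ∑ i ∈ range p, ℓ * x ^ i * (c + 3 / 2 * (ℓ * x ^ i)) ≤ 2 * τ * (u * x ^ 3 + u) := by
    intro p hp
    have hle : ∑ i ∈ range p, ℓ * x ^ i * (c + 3 / 2 * (ℓ * x ^ i)) ≤ u / 2 * (c + u) := by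
      rcases hp with hp | rfl
      · rw [hu]
        exact sum_small_moments_le hx hℓ hc0.le hp
      · rw [sum_range_zero]
        positivity
    have : 0 ≤ u ^ 2 * ((x ^ 2 - 1) * (x ^ 3 + 1) / 2 - (x ^ 3 / 4 + x / 2 + 1 / 8) -
        (x ^ 3 / 2 + x ^ 2 + 1) / 2) := by
      apply mul_nonneg (by positivity)
      linarith
    have hcu : u / 2 * (c + u) = u ^ 2 * ((x ^ 3 / 2 + x ^ 2 + 1) / 2) := by rw [hc]; ring
    linarith
  intro j hj
  rw [mem_Icc] at hj
  rcases (show j = 1 ∨ j = 2 ∨ j = k + 3 ∨ j = k + 4 ∨ ∃ p, j = p + 3 ∧ p < k by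
    by_cases h1 : j = 1
    · exact Or.inl h1
    by_cases h2 : j = 2
    · exact Or.inr (Or.inl h2)
    by_cases h3 : j = k + 3
    · exact Or.inr (Or.inr (Or.inl h3))
    by_cases h4 : j = k + 4
    · exact Or.inr (Or.inr (Or.inr (Or.inl h4)))
    · exact Or.inr (Or.inr (Or.inr (Or.inr ⟨j - 3, by omega, by omega⟩)))) with
    rfl | rfl | rfl | rfl | ⟨p, rfl, hp⟩
  · rw [Icc_self, sum_singleton, sum_singleton, hw1, hm1, mul_zero]
    exact ⟨le_rfl, by positivity⟩
  · have htwo : ∀ f : ℕ → ℝ, ∑ i ∈ Icc 1 2, f i = f 1 + f 2 := fun f => by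
      simp [sum_Icc_succ_top]
    rw [htwo, htwo, hw1, hm1, mul_zero, zero_add, hw2]
    exact ⟨by rw [hm2]; positivity, hsecond⟩
  · rw [hlast, hW k le_rfl]
    have := hpos k
    exact ⟨le_rfl, by positivity⟩
  · have hsucc : ∀ f : ℕ → ℝ, ∑ i ∈ Icc 1 (k + 4), f i = ∑ i ∈ Icc 1 (k + 3), f i + f (k + 4) :=
      fun f => sum_Icc_succ_top (by omega) f
    rw [hsucc, hsucc, hlast, hW k le_rfl, hwn, hmn]
    exact ⟨by positivity, by linarith⟩
  · rw [hS p (Or.inl hp), hW p hp.le]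
    refine ⟨add_nonneg hE0 (hg0 p), (hsmall p (Or.inl hp)).trans ?_⟩
    have := hpos p
    exact mul_le_mul_of_nonneg_left (by nlinarith) hτ0

/-- The separation and moment conditions hold for suitable midpoints. -/
theorem exists_midpoints (k : ℕ) {x ℓ τ : ℝ} (hx : 2 ≤ x) (hℓ : 0 < ℓ)
    (hτ : 4 * τ * ∑ i ∈ Icc 1 (k + 4), ℓ * x ^ (i - 1) =
      (ℓ * x ^ (k + 3) + ℓ * x ^ (k + 2)) * (ℓ * x ^ (k + 2))) :
    ∃ m : ℕ → ℝ,
      (∀ i ∈ Icc 1 (k + 4), ∀ j ∈ Icc 1 (k + 4), i ≠ j →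
        m i + ℓ * x ^ (placementOrder k i - 1) / 2 ≤ m j - ℓ * x ^ (placementOrder k j - 1) / 2 ∨
        m j + ℓ * x ^ (placementOrder k j - 1) / 2 ≤
          m i - ℓ * x ^ (placementOrder k i - 1) / 2) ∧
      (∀ j ∈ Icc 1 (k + 4),
        0 ≤ ∑ i ∈ Icc 1 j, ℓ * x ^ (placementOrder k i - 1) * m i ∧
        ∑ i ∈ Icc 1 j, ℓ * x ^ (placementOrder k i - 1) * m i ≤
          2 * τ * ∑ i ∈ Icc 1 j, ℓ * x ^ (placementOrder k i - 1)) := by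
  have hx0 : 0 < x := by linarith
  set w : ℕ → ℝ := fun j => ℓ * x ^ (placementOrder k j - 1) with hw
  have hwdef : ∀ j, ℓ * x ^ (placementOrder k j - 1) = w j := fun j => rfl
  simp only [hwdef]
  obtain ⟨u, hu⟩ : ∃ u, u = ℓ * x ^ k := ⟨_, rfl⟩
  have hu0 : 0 < u := by rw [hu]; positivity
  have hw1 : w 1 = u * x ^ 3 := by
    simp only [hw, hu, placementOrder]; simp; ring
  have hw2 : w 2 = u := by
    simp only [hw, hu, placementOrder]; simp
  have hw3 : w 3 = u * x := by
    simp only [hw, hu, placementOrder]; simp; ring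
  have hwn : w (k + 4) = u * x ^ 2 := by
    simp only [hw, hu, placementOrder]; simp; ring
  have hwi : ∀ i < k, w (i + 4) = ℓ * x ^ i := by
    intro i hi
    have h1 : ¬ (i = k) := by omega
    simp only [hw, placementOrder]; simp [h1]
  obtain ⟨t, ht⟩ : ∃ t, t = if k = 0 then 0 else ℓ * x ^ (k - 1) := ⟨_, rfl⟩
  have ht0 : 0 ≤ t := by rw [ht]; split_ifs <;> positivity
  have htu : 2 * t ≤ u := by
    rw [ht, hu]
    rcases k with _ | k
    · simpa using hℓ.le
    · simp only [Nat.add_sub_cancel, pow_succ, Nat.succ_ne_zero, if_false]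
      have : 0 < ℓ * x ^ k := by positivity
      nlinarith
  obtain ⟨c, hc⟩ : ∃ c, c = u * x ^ 3 / 2 + u * x ^ 2 := ⟨_, rfl⟩
  have hc0 : 0 < c := by rw [hc]; positivity
  obtain ⟨E, hE⟩ : ∃ E, E = t * (u * x ^ 3 / 2 + u * x + t / 2) := ⟨_, rfl⟩
  have hE0 : 0 ≤ E := by rw [hE]; positivity
  have hEu : E ≤ u ^ 2 * (x ^ 3 / 4 + x / 2 + 1 / 8) := by
    have : 0 ≤ u * x ^ 3 / 2 + u * x := by positivity
    rw [hE]
    nlinarith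
  obtain ⟨g, hg⟩ : ∃ g : ℕ → ℝ, g = fun i => ℓ * x ^ i * (c + 3 / 2 * (ℓ * x ^ i)) := ⟨_, rfl⟩
  have hg0 : ∀ p, 0 ≤ ∑ i ∈ range p, g i := fun p =>
    sum_nonneg fun i _ => by rw [hg]; positivity
  obtain ⟨D, hD⟩ : ∃ D, D = (E + ∑ i ∈ range (k - 1), g i) / t := ⟨_, rfl⟩
  obtain ⟨m, hm⟩ : ∃ m : ℕ → ℝ, m = fun j =>
      if j = 1 then 0 else if j = 2 then (u * x * (u * x ^ 3 + u * x) / 2 + E) / u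
      else if j = 3 then -(u * x ^ 3 + u * x) / 2 else if j = k + 4 then (u * x ^ 3 + u * x ^ 2) / 2
      else if j = k + 3 then -D else c + 3 / 2 * w j := ⟨_, rfl⟩
  have hm1 : m 1 = 0 := by simp [hm]
  have hm2 : m 2 = (u * x * (u * x ^ 3 + u * x) / 2 + E) / u := by simp [hm]
  have hm3 : m 3 = -(u * x ^ 3 + u * x) / 2 := by simp [hm]
  have hmn : m (k + 4) = (u * x ^ 3 + u * x ^ 2) / 2 := by simp [hm]
  have hmi : ∀ i, i + 1 < k → m (i + 4) = c + 3 / 2 * w (i + 4) := by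
    intro i hi
    have h1 : ¬ (i = k) := by omega
    have h2 : ¬ (i + 4 = k + 3) := by omega
    simp [hm, h1, h2]
  have hml : 0 < k → m (k + 3) = -D := by
    intro hk
    have h1 : k ≠ 0 := by omega
    simp [hm, h1]
  have hwl : 0 < k → w (k + 3) = t := by
    intro hk
    have := hwi (k - 1) (by omega)
    rw [show k - 1 + 4 = k + 3 by omega] at this
    rw [this, ht, if_neg (by omega)]
  have htD : 0 < k → 0 < t ∧ t * D = E + ∑ i ∈ range (k - 1), g i := by
    intro hk
    have h : 0 < t := by rw [ht, if_neg (by omega)]; positivity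
    refine ⟨h, ?_⟩
    rw [hD]
    field_simp
  obtain ⟨hx2, hx2', hx3, hx4, hx5⟩ := pow_growth hx
  have hm2' : u * m 2 = u * x * (u * x ^ 3 + u * x) / 2 + E := by
    rw [hm2]; field_simp
  have hm2le : c + u ≤ m 2 - u / 2 := by
    have h2 : u * (c + u + u / 2) ≤ u * m 2 := by
      rw [hm2', hc]
      have : 0 ≤ u ^ 2 * (x ^ 4 + x ^ 2 - x ^ 3 - 2 * x ^ 2 - 3) := by
        apply mul_nonneg (by positivity); linarith
      linarith
    have := le_of_mul_le_mul_left h2 hu0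
    linarith
  refine ⟨m, ?_, ?_⟩
  · refine separated_of_midpoints hx hℓ hu hc hw1 hm1 hw2 hm2le hw3 hm3 hwn hmn ?_ hwi hmi
    intro hk
    obtain ⟨h1, h2⟩ := htD hk
    have : u * x ^ 3 / 2 + u * x + t / 2 ≤ D := by
      refine le_of_mul_le_mul_left ?_ h1
      rw [h2, hE]
      linarith [hg0 (k - 1)]
    rw [hml hk, hwl hk]
    linarith
  · refine moments_of_midpoints hx hℓ hu hc hE0 hEu ?_ hw1 hm1 hw2 hm2' hw3 hm3 hwn hmn hwi hmi
      ?_ hτ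
    · intro hk
      rw [hE, ht, if_pos hk, zero_mul]
    · intro hk
      rw [hml hk, hwl hk, mul_neg, (htD hk).2, hg]

/-- For n ≥ 4, x ≥ 2, ℓ > 0, there exists a plane placement of the
exponential system of lengths ℓ, ℓx, ..., ℓx^{n−1} (in some order, as closed intervals
with pairwise disjoint interiors) whose deviation satisfies Δ ≤ τ, where
τ = (ℓ′ + ℓ″)·ℓ″ / (4·Σ_i ℓx^{i−1}), ℓ′ = ℓx^{n−1}, ℓ″ = ℓx^{n−2}. -/
theorem stmt_12 (n : ℕ) (hn : 4 ≤ n) (x ℓ : ℝ) (hx : 2 ≤ x) (hℓ : 0 < ℓ) :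
    ∃ lo hi : ℕ → ℝ,
      (∀ j ∈ Finset.Icc 1 n, lo j ≤ hi j) ∧
      (∀ i ∈ Finset.Icc 1 n, ∀ j ∈ Finset.Icc 1 n, i ≠ j →
        Disjoint (Set.Ioo (lo i) (hi i)) (Set.Ioo (lo j) (hi j))) ∧
      (∃ σ : ℕ → ℕ, Set.BijOn σ (Set.Icc 1 n) (Set.Icc 1 n) ∧
        ∀ j ∈ Finset.Icc 1 n, hi j - lo j = ℓ * x ^ (σ j - 1)) ∧
      (∀ j ∈ Finset.Icc 0 n,
        |(∑ i ∈ Finset.Icc 1 j, (hi i - lo i) * ((lo i + hi i) / 2)) /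
            (∑ i ∈ Finset.Icc 1 j, (hi i - lo i))| ≤
          (ℓ * x ^ (n - 1) + ℓ * x ^ (n - 2)) * (ℓ * x ^ (n - 2)) /
            (4 * ∑ i ∈ Finset.Icc 1 n, ℓ * x ^ (i - 1))) := by
  obtain ⟨k, rfl⟩ : ∃ k, n = k + 4 := ⟨n - 4, by omega⟩
  have hx0 : 0 < x := by linarith
  have hL : 0 < ∑ i ∈ Finset.Icc 1 (k + 4), ℓ * x ^ (i - 1) :=
    Finset.sum_pos (fun i _ => by positivity) ⟨1, by simp⟩
  simp only [show k + 4 - 1 = k + 3 by omega, show k + 4 - 2 = k + 2 by omega]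
  obtain ⟨m, hsep, hmom⟩ := exists_midpoints k (τ :=
    (ℓ * x ^ (k + 3) + ℓ * x ^ (k + 2)) * (ℓ * x ^ (k + 2)) /
      (4 * ∑ i ∈ Finset.Icc 1 (k + 4), ℓ * x ^ (i - 1))) hx hℓ (by field_simp)
  obtain ⟨lo, hi, hle, hdisj, hlen, hdev⟩ :=
    exists_placement_of_moments (by positivity) (fun j _ => by positivity) hsep hmom
  exact ⟨lo, hi, hle, hdisj, ⟨placementOrder k, placementOrder_bijOn k, fun j _ => hlen j⟩, hdev⟩
end

section
/- Let n ≥ 4, x ≥ 2, ℓ > 0, and consider a plane placement of the exponential system of lengths ℓ, ℓx, ..., ℓx^{n−1} in which the first placed interval does NOT have the largest length ℓx^{n−1}. Then the deviation of the placement satisfies Δ > τ, where τ = (ℓ′ + ℓ″)·ℓ″ / (4·Σ_{i=1}^{n} ℓx^{i−1}) with ℓ′ = ℓx^{n−1} and ℓ″ = ℓx^{n−2}. -/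
/-- The midpoints of two nondegenerate intervals with disjoint interiors are at least half
the sum of the lengths apart. -/
theorem half_add_le_abs_midpoint_sub {a b c d : ℝ} (hab : a < b) (hcd : c < d)
    (h : Disjoint (Set.Ioo a b) (Set.Ioo c d)) :
    ((b - a) + (d - c)) / 2 ≤ |(c + d) / 2 - (a + b) / 2| := by
  rw [Set.Ioo_disjoint_Ioo, min_le_iff, le_max_iff, le_max_iff] at h
  rcases h with (h | h) | (h | h)
  · linarith
  · exact le_trans (by linarith) (le_abs_self _)
  · exact le_trans (by linarith) (neg_le_abs _)
  · linarith

/-- For n ≥ 4, x ≥ 2, ℓ > 0, every plane placement of the exponential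
system of lengths ℓ, ℓx, ..., ℓx^{n−1} in which the first placed interval does NOT
have the largest length ℓx^{n−1} has deviation Δ > τ, where
τ = (ℓ′ + ℓ″)·ℓ″ / (4·Σ_i ℓx^{i−1}), ℓ′ = ℓx^{n−1}, ℓ″ = ℓx^{n−2}. -/
theorem stmt_13 (n : ℕ) (hn : 4 ≤ n) (x ℓ : ℝ) (hx : 2 ≤ x) (hℓ : 0 < ℓ)
    (lo hi : ℕ → ℝ)
    (hle : ∀ j ∈ Finset.Icc 1 n, lo j ≤ hi j)
    (hdisj : ∀ i ∈ Finset.Icc 1 n, ∀ j ∈ Finset.Icc 1 n, i ≠ j →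
      Disjoint (Set.Ioo (lo i) (hi i)) (Set.Ioo (lo j) (hi j)))
    (σ : ℕ → ℕ) (hσ : Set.BijOn σ (Set.Icc 1 n) (Set.Icc 1 n))
    (hlen : ∀ j ∈ Finset.Icc 1 n, hi j - lo j = ℓ * x ^ (σ j - 1))
    (hfirst : hi 1 - lo 1 ≠ ℓ * x ^ (n - 1)) :
    (ℓ * x ^ (n - 1) + ℓ * x ^ (n - 2)) * (ℓ * x ^ (n - 2)) /
        (4 * ∑ i ∈ Finset.Icc 1 n, ℓ * x ^ (i - 1)) <
      (Finset.Icc 0 n).sup' (Finset.nonempty_Icc.mpr (Nat.zero_le n))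
        (fun j => |(∑ i ∈ Finset.Icc 1 j, (hi i - lo i) * ((lo i + hi i) / 2)) /
          (∑ i ∈ Finset.Icc 1 j, (hi i - lo i))|) := by
  by_contra! hcon
  rw [Finset.sup'_le_iff] at hcon
  set L := ℓ * x ^ (n - 1) with hL
  set K := ℓ * x ^ (n - 2) with hK
  set S := ∑ i ∈ Finset.Icc 1 n, ℓ * x ^ (i - 1) with hS
  set τ := (L + K) * K / (4 * S) with hτ
  have hlen_pos : ∀ j ∈ Finset.Icc 1 n, 0 < hi j - lo j := fun j hj => by
    rw [hlen j hj]; positivity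
  have hKpos : 0 < K := by positivity
  have hLK : L = x * K := by
    rw [hL, hK, show n - 1 = n - 2 + 1 by omega, pow_succ]; ring
  have hL2 : 2 * K ≤ L := by rw [hLK]; gcongr
  have hSpos : 0 < S :=
    Finset.sum_pos (fun i _ => by positivity) (Finset.nonempty_Icc.mpr (by omega))
  have htotal : ∑ i ∈ Finset.Icc 1 n, (hi i - lo i) = S := by
    rw [Finset.sum_congr rfl hlen]
    rw [← Finset.coe_Icc] at hσ
    exact Finset.sum_nbij σ (fun i hi => hσ.mapsTo hi) hσ.injOn hσ.surjOn fun _ _ => rfl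
  have hmoment : ∀ j ∈ Finset.Icc 0 n,
      |∑ i ∈ Finset.Icc 1 j, (hi i - lo i) * ((lo i + hi i) / 2)| ≤
        τ * ∑ i ∈ Finset.Icc 1 j, (hi i - lo i) := by
    intro j hj
    obtain rfl | hj0 := Nat.eq_zero_or_pos j
    · simp
    have hpos : 0 < ∑ i ∈ Finset.Icc 1 j, (hi i - lo i) :=
      Finset.sum_pos (fun i hi => hlen_pos i (by simp only [Finset.mem_Icc] at *; omega))
        (Finset.nonempty_Icc.mpr hj0)
    have h := hcon j hj
    rwa [abs_div, abs_of_pos hpos, div_le_iff₀ hpos] at h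
  obtain ⟨k, hk, hkn⟩ := hσ.surjOn (show n ∈ Set.Icc 1 n from ⟨by omega, le_rfl⟩)
  have hk' : k ∈ Finset.Icc 1 n := Finset.mem_Icc.mpr hk
  have h1 : 1 ∈ Finset.Icc 1 n := Finset.mem_Icc.mpr ⟨le_rfl, by omega⟩
  have hkL : hi k - lo k = L := by rw [hlen k hk', hkn]
  have hk1 : 1 ≠ k := by
    rintro rfl
    exact hfirst hkL
  have hsep := half_add_le_abs_midpoint_sub (sub_pos.mp (hlen_pos 1 h1))
    (sub_pos.mp (hlen_pos k hk')) (hdisj 1 h1 k hk' hk1)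
  have hmass : ∑ i ∈ Finset.Icc 1 k, (hi i - lo i) ≤ S := by
    rw [← htotal]
    exact Finset.sum_le_sum_of_subset_of_nonneg (Finset.Icc_subset_Icc_right hk.2)
      fun i hi _ => (hlen_pos i hi).le
  have hfirst_mid : |(lo 1 + hi 1) / 2| ≤ τ := by
    simpa [abs_div, (hlen_pos 1 h1).ne'] using hcon 1 (Finset.mem_Icc.mpr ⟨by omega, by omega⟩)
  have hbefore := hmoment (k - 1) (Finset.mem_Icc.mpr ⟨by omega, by have := hk.2; omega⟩)
  have hafter := hmoment k (Finset.mem_Icc.mpr ⟨by omega, hk.2⟩)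
  obtain ⟨m, rfl⟩ : ∃ m, k = m + 1 := ⟨k - 1, by have := hk.1; omega⟩
  rw [Nat.add_sub_cancel] at hbefore
  rw [Finset.sum_Icc_succ_top (by omega)] at hmass
  rw [Finset.sum_Icc_succ_top (by omega), Finset.sum_Icc_succ_top (by omega)] at hafter
  rw [hkL] at hsep hmass hafter
  have hLpos : 0 < L := by linarith
  have hτ0 : 0 ≤ τ := by positivity
  have hτS : 4 * (τ * S) = (L + K) * K := by rw [hτ]; field_simp
  have hmid : L * |(lo (m + 1) + hi (m + 1)) / 2| ≤
      τ * (2 * ∑ i ∈ Finset.Icc 1 m, (hi i - lo i) + L) := by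
    rw [← abs_of_pos hLpos, ← abs_mul, abs_of_pos hLpos]
    rw [abs_le] at hbefore hafter ⊢
    constructor <;> linarith
  have hgap : L * ((hi 1 - lo 1 + L) / 2) ≤
      L * (|(lo (m + 1) + hi (m + 1)) / 2| + |(lo 1 + hi 1) / 2|) :=
    mul_le_mul_of_nonneg_left (hsep.trans (abs_sub _ _)) hLpos.le
  have hmass_scaled := mul_le_mul_of_nonneg_left hmass hτ0
  have hfirst_scaled := mul_le_mul_of_nonneg_left hfirst_mid hLpos.le
  have hextra := mul_pos hLpos (hlen_pos 1 h1)
  nlinarith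
end

section
/- For every real number x ≥ 2 and every integer n ≥ 6, the inequality x^{n+7} + x^{n+3} + x^5 + x^4 + x^2 + 1 ≥ 2x^{n+5} + x^{n+2} + x^n + x^7 + x^6 holds. -/
/-- condition S1.1: For x ≥ 2 and n ≥ 6,
x^{n+7} + x^{n+3} + x^5 + x^4 + x^2 + 1 ≥ 2x^{n+5} + x^{n+2} + x^n + x^7 + x^6. -/
theorem stmt_15 (x : ℝ) (hx : 2 ≤ x) (n : ℕ) (hn : 6 ≤ n) :
    2 * x ^ (n + 5) + x ^ (n + 2) + x ^ n + x ^ 7 + x ^ 6 ≤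
      x ^ (n + 7) + x ^ (n + 3) + x ^ 5 + x ^ 4 + x ^ 2 + 1 := by
  have hpow : x ^ 6 ≤ x ^ n := pow_le_pow_right₀ (by linarith) hn
  have hfactor : x + 1 ≤ x ^ 7 - 2 * x ^ 5 + x ^ 3 - x ^ 2 - 1 := by
    obtain ⟨t, rfl⟩ : ∃ t, x = 2 + t := ⟨x - 2, by ring⟩
    have ht : 0 ≤ t := by linarith
    rw [← sub_nonneg]
    ring_nf
    positivity
  have hmul : x ^ 6 * (x + 1) ≤ x ^ n * (x ^ 7 - 2 * x ^ 5 + x ^ 3 - x ^ 2 - 1) :=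
    mul_le_mul hpow hfactor (by linarith) (by positivity)
  have hrest : 0 ≤ x ^ 5 + x ^ 4 + x ^ 2 + 1 := by positivity
  simp only [pow_add]
  linarith
end

section
/- For every real number x ≥ 2 and every integer n ≥ 4, the inequality x^{n+5} + x^{n+2} + x^{n+1} + x^4 + x^2 ≥ 2x^{n+4} + x^n + x^5 + x holds. -/
/-- condition S1.2: For x ≥ 2 and n ≥ 4,
x^{n+5} + x^{n+2} + x^{n+1} + x^4 + x^2 ≥ 2x^{n+4} + x^n + x^5 + x. -/
theorem stmt_16 (x : ℝ) (hx : 2 ≤ x) (n : ℕ) (hn : 4 ≤ n) :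
    2 * x ^ (n + 4) + x ^ n + x ^ 5 + x ≤
      x ^ (n + 5) + x ^ (n + 2) + x ^ (n + 1) + x ^ 4 + x ^ 2 := by
  have hP : x ^ 2 + x - 1 ≤ x ^ 5 - 2 * x ^ 4 + x ^ 2 + x - 1 := by
    have : 0 ≤ x ^ 4 * (x - 2) := mul_nonneg (by positivity) (by linarith)
    linarith
  have hQ : 0 ≤ x ^ 2 + x - 1 := by nlinarith
  have hpow : x ^ 4 ≤ x ^ n := pow_le_pow_right₀ (by linarith) hn
  have hmul : x ^ 4 * (x ^ 2 + x - 1) ≤ x ^ n * (x ^ 5 - 2 * x ^ 4 + x ^ 2 + x - 1) :=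
    mul_le_mul hpow hP hQ (by positivity)
  have hrest : x ^ 5 - x ^ 4 - x ^ 2 + x ≤ x ^ 4 * (x ^ 2 + x - 1) := by
    have h6 : 0 ≤ x ^ 6 := by positivity
    nlinarith
  simp only [pow_add x n]
  linarith
end

section
/- For every real number x ≥ 2 and every integer n ≥ 4, the inequality x^{n+5} + x^{n+1} + x^3 + 2x^2 + 1 ≥ 2x^{n+3} + x^{n+2} + x^n + x^5 + x^4 holds. -/
/-- condition S1.3: For x ≥ 2 and n ≥ 4,
x^{n+5} + x^{n+1} + x^3 + 2x^2 + 1 ≥ 2x^{n+3} + x^{n+2} + x^n + x^5 + x^4. -/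
theorem stmt_17 (x : ℝ) (hx : 2 ≤ x) (n : ℕ) (hn : 4 ≤ n) :
    2 * x ^ (n + 3) + x ^ (n + 2) + x ^ n + x ^ 5 + x ^ 4 ≤
      x ^ (n + 5) + x ^ (n + 1) + x ^ 3 + 2 * x ^ 2 + 1 := by
  have h4 : x ^ 4 ≤ x ^ n := pow_le_pow_right₀ (by linarith) hn
  have hx3 : 2 * x ^ 2 ≤ x ^ 3 := by nlinarith [sq_nonneg x]
  have hx5 : 4 * x ^ 3 ≤ x ^ 5 := by
    nlinarith [mul_le_mul_of_nonneg_left hx3 (sq_nonneg x),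
      mul_le_mul_of_nonneg_left hx (by positivity : 0 ≤ x ^ 3)]
  have hfactor : x + 1 ≤ x ^ 5 - 2 * x ^ 3 - x ^ 2 + x - 1 := by nlinarith
  have hprod : x ^ 4 * (x + 1) ≤ x ^ n * (x ^ 5 - 2 * x ^ 3 - x ^ 2 + x - 1) :=
    mul_le_mul h4 hfactor (by linarith) (by positivity)
  have hpos : 0 ≤ x ^ 3 + 2 * x ^ 2 + 1 := by positivity
  simp only [pow_add x n]
  linarith
end

section
/- For every real number x ≥ 2 and every integer n ≥ 5, the inequality x^{2n}·(x^{−2} − x^{−4})·(x^{n+2} − x^n − x^{n−1} − x^3 − 2x^2 − 2x − 1) ≥ (x^3 + x + 1)·(x^n − 1)·(x^3 + x^4) holds. -/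
theorem quintic_le_septic {x : ℝ} (hx : 2 ≤ x) :
    (x ^ 3 + x + 1) * x ^ 2 ≤ x ^ 7 - x ^ 5 - x ^ 4 - x ^ 3 - 2 * x ^ 2 - 2 * x - 1 := by
  obtain ⟨u, hu, rfl⟩ : ∃ u : ℝ, 0 ≤ u ∧ x = 2 + u := ⟨x - 2, by linarith, by ring⟩
  rw [← sub_nonneg]
  ring_nf
  positivity


/-- condition S1.4: For x ≥ 2 and n ≥ 5,
x^{2n}·(x^{−2} − x^{−4})·(x^{n+2} − x^n − x^{n−1} − x^3 − 2x^2 − 2x − 1)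
  ≥ (x^3 + x + 1)·(x^n − 1)·(x^3 + x^4). -/
theorem stmt_18 (x : ℝ) (hx : 2 ≤ x) (n : ℕ) (hn : 5 ≤ n) :
    (x ^ 3 + x + 1) * (x ^ n - 1) * (x ^ 3 + x ^ 4) ≤
      x ^ (2 * n) * (x ^ (-2 : ℤ) - x ^ (-4 : ℤ)) *
        (x ^ (n + 2) - x ^ n - x ^ (n - 1) - x ^ 3 - 2 * x ^ 2 - 2 * x - 1) := by
  obtain ⟨m, rfl⟩ := Nat.exists_eq_add_of_le hn
  have hx0 : x ≠ 0 := by positivity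
  have ht : 1 ≤ x ^ m := one_le_pow₀ (by linarith)
  have hz : x ^ (2 * (5 + m)) * (x ^ (-2 : ℤ) - x ^ (-4 : ℤ)) =
      (x ^ m) ^ 2 * x ^ 6 * (x ^ 2 - 1) := by
    have h2 : x ^ (-2 : ℤ) = (x ^ 2)⁻¹ := by
      rw [zpow_neg]; norm_cast
    have h4 : x ^ (-4 : ℤ) = (x ^ 4)⁻¹ := by
      rw [zpow_neg]; norm_cast
    rw [h2, h4]
    field_simp
    ring
  have e1 : x ^ (5 + m + 2) = x ^ 7 * x ^ m := by ring
  have e2 : x ^ (5 + m) = x ^ 5 * x ^ m := by ring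
  have e3 : x ^ (5 + m - 1) = x ^ 4 * x ^ m := by
    rw [show 5 + m - 1 = 4 + m by omega, pow_add]
  rw [hz, e1, e2, e3]
  generalize x ^ m = t at ht ⊢
  have hP := quintic_le_septic hx
  set P := x ^ 7 - x ^ 5 - x ^ 4 - x ^ 3 - 2 * x ^ 2 - 2 * x - 1 with hPdef
  have hPx : (x ^ 3 + x + 1) * x ^ 2 ≤ (x - 1) * P := by
    have : 0 ≤ (x ^ 3 + x + 1) * x ^ 2 := by positivity
    nlinarith
  have hx1 : 0 ≤ x ^ 2 - 1 := by nlinarith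
  calc (x ^ 3 + x + 1) * (x ^ 5 * t - 1) * (x ^ 3 + x ^ 4)
      ≤ (x ^ 3 + x + 1) * (x ^ 5 * t) * (x ^ 3 + x ^ 4) := by
        gcongr
        linarith
    _ = t * (x ^ 6 * (x + 1)) * ((x ^ 3 + x + 1) * x ^ 2) := by ring
    _ ≤ t ^ 3 * (x ^ 6 * (x + 1)) * ((x - 1) * P) := by
        gcongr
        exact le_self_pow₀ ht (by norm_num)
    _ = t ^ 2 * x ^ 6 * (x ^ 2 - 1) * (t * P) := by ring
    _ ≤ t ^ 2 * x ^ 6 * (x ^ 2 - 1) *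
        (x ^ 7 * t - x ^ 5 * t - x ^ 4 * t - x ^ 3 - 2 * x ^ 2 - 2 * x - 1) := by
        gcongr
        have : 0 ≤ (t - 1) * (x ^ 3 + 2 * x ^ 2 + 2 * x + 1) :=
          mul_nonneg (by linarith) (by positivity)
        rw [hPdef]
        linarith
end
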